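/- Let d ≥ 2, q ≥ 2 be natural numbers, let α > d be real, let J > 0, and let φ : ZMod q → ℝ satisfy φ(0) > φ(n) for every n ≠ 0. Then for every C ∈ [0,1) there exists β₀ > 0 (depending on C, α, d, φ, q, J) such that for every β > β₀, every finite Λ ⊂ ℤ^d with 0 ∈ Λ and every r ∈ ZMod q, the finite-volume Gibbs measure with monochromatic boundary condition r satisfies μ^r_{Λ,β}({σ : σ_0 = r}) > C, i.e. (∑_{σ∈Ω_Λ^r, σ_0=r} e^{−βH^r_Λ(σ)}) / (∑_{σ∈Ω_Λ^r} e^{−βH^r_Λ(σ)}) > C. -/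

import Mathlib

open scoped BigOperators
open Filter

noncomputable section

/-- The lattice `ℤ^d`. -/
abbrev Zd (d : ℕ) := Fin d → ℤ

/-- The ℓ¹-norm on `ℤ^d`. -/
def l1 {d : ℕ} (x : Zd d) : ℤ := ∑ i, |x i|

/-- Long-range couplings `J_{xy} = J / |x-y|^α` for `x ≠ y`, and `J_{xx} = 0`. -/
noncomputable def Jcoup (d : ℕ) (J α : ℝ) (x y : Zd d) : ℝ :=
  if x = y then 0 else J / ((l1 (x - y) : ℝ) ^ α)

/-- The configuration in `Ω_Λ^η` determined by `σ : Λ → ZMod q` (boundary condition `η`). -/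
def extendCfg {d q : ℕ} (Λ : Finset (Zd d)) (η : Zd d → ZMod q) (σ : Λ → ZMod q) :
    Zd d → ZMod q :=
  fun x => if hx : x ∈ Λ then σ ⟨x, hx⟩ else η x

/-- The Hamiltonian `H^r_Λ(σ) = -∑_{{x,y}⊆Λ} J_{xy} φ(σ_x-σ_y)
    - ∑_{x∈Λ} ∑_{y∉Λ} J_{xy} φ(σ_x-r)` with monochromatic boundary condition `r`.
    (The sum over unordered pairs `{x,y} ⊆ Λ` is written as half the sum over ordered
    pairs, the diagonal contributing nothing since `J_{xx} = 0`.) -/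
noncomputable def ham (d q : ℕ) (J α : ℝ) (φ : ZMod q → ℝ) (Λ : Finset (Zd d))
    (r : ZMod q) (σ : Zd d → ZMod q) : ℝ :=
  -(1 / 2) * (∑ x ∈ Λ, ∑ y ∈ Λ, Jcoup d J α x y * φ (σ x - σ y))
    - ∑ x ∈ Λ, ∑' y : Zd d, (if y ∈ Λ then 0 else Jcoup d J α x y * φ (σ x - r))

/-- The ℓ¹-norm on `ℤ^d` with values in `ℕ`. -/
def natNorm {d : ℕ} (x : Zd d) : ℕ := ∑ i, (x i).natAbs

section Norm
variable {d : ℕ}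

lemma l1_eq_natNorm (x : Zd d) : l1 x = (natNorm x : ℤ) := by
  simp [l1, natNorm]

lemma natNorm_zero : natNorm (0 : Zd d) = 0 := by simp [natNorm]

lemma natNorm_add_le (x y : Zd d) : natNorm (x + y) ≤ natNorm x + natNorm y := by
  rw [natNorm, natNorm, natNorm, ← Finset.sum_add_distrib]
  exact Finset.sum_le_sum fun i _ => Int.natAbs_add_le _ _

lemma natNorm_neg (x : Zd d) : natNorm (-x) = natNorm x := by simp [natNorm]

lemma natNorm_sub_comm (x y : Zd d) : natNorm (x - y) = natNorm (y - x) := by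
  rw [← natNorm_neg, neg_sub]

lemma natNorm_sub_le (x y z : Zd d) :
    natNorm (x - z) ≤ natNorm (x - y) + natNorm (y - z) := by
  have := natNorm_add_le (x - y) (y - z)
  rwa [sub_add_sub_cancel] at this

lemma natNorm_eq_zero {x : Zd d} : natNorm x = 0 ↔ x = 0 := by
  simp [natNorm, funext_iff]

lemma natNorm_single (i : Fin d) (k : ℤ) :
    natNorm (Pi.single i k : Zd d) = k.natAbs := by
  rw [natNorm, Finset.sum_eq_single i]
  · simp
  · intro j _ hj; simp [hj]
  · simp

lemma natAbs_le_natNorm (x : Zd d) (i : Fin d) : (x i).natAbs ≤ natNorm x :=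
  Finset.single_le_sum (f := fun i => (x i).natAbs) (fun _ _ => Nat.zero_le _) (Finset.mem_univ i)

/-- The summable weight `(1 + |z|)^(-p)`. -/
def polyWeight (p : ℝ) (z : Zd d) : ENNReal := ENNReal.ofReal ((1 + natNorm z : ℝ) ^ (-p))

/-- A sum of products over finitely many functions is at most the product of the full sums. -/
lemma sum_prod_le_tsum_pow {ι β : Type*} [Fintype ι] [DecidableEq ι] (g : β → ENNReal)
    (s : Finset (ι → β)) : ∑ f ∈ s, ∏ i, g (f i) ≤ (∑' b, g b) ^ Fintype.card ι := by
  classical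
  let t : Finset β := s.biUnion fun f => Finset.univ.image f
  calc ∑ f ∈ s, ∏ i, g (f i) ≤ ∑ f ∈ Fintype.piFinset fun _ : ι => t, ∏ i, g (f i) := by
        refine Finset.sum_le_sum_of_subset fun f hf => ?_
        simp only [Fintype.mem_piFinset, t, Finset.mem_biUnion, Finset.mem_image]
        exact fun i => ⟨f, hf, i, Finset.mem_univ _, rfl⟩
    _ = ∏ _i : ι, ∑ b ∈ t, g b := (Finset.prod_univ_sum (fun _ => t) fun _ => g).symm
    _ = (∑ b ∈ t, g b) ^ Fintype.card ι := by simp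
    _ ≤ _ := by gcongr; exact ENNReal.sum_le_tsum t

lemma tsum_int_rpow_ne_top {s : ℝ} (hs : 1 < s) :
    ∑' k : ℤ, ENNReal.ofReal ((1 + k.natAbs : ℝ) ^ (-s)) ≠ ⊤ := by
  have h : Summable fun n : ℕ => ((1 + n : ℝ) ^ (-s)) := by
    have := (Real.summable_one_div_nat_add_rpow 1 s).2 hs
    refine this.congr fun n => ?_
    rw [abs_of_nonneg (by positivity), Real.rpow_neg (by positivity), one_div, add_comm]
  have h2 : Summable fun k : ℤ => ((1 + k.natAbs : ℝ) ^ (-s)) :=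
    Summable.of_nat_of_neg (by simpa using h) (by simpa using h)
  exact h2.tsum_ofReal_ne_top

lemma tsum_polyWeight_ne_top {p : ℝ} (hd : 0 < d) (hp : (d : ℝ) < p) :
    ∑' z : Zd d, polyWeight p z ≠ ⊤ := by
  have hd' : (0 : ℝ) < d := by exact_mod_cast hd
  have hs : 1 < p / d := by rwa [one_lt_div hd']
  let g : ℤ → ENNReal := fun k => ENNReal.ofReal ((1 + k.natAbs : ℝ) ^ (-(p / d)))
  have key : ∀ z : Zd d, polyWeight p z ≤ ∏ i, g (z i) := by
    intro z
    simp only [g, polyWeight]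
    rw [← ENNReal.ofReal_prod_of_nonneg (fun i _ => by positivity)]
    apply ENNReal.ofReal_le_ofReal
    calc ((1 + natNorm z : ℝ) ^ (-p)) = ∏ _i : Fin d, (1 + natNorm z : ℝ) ^ (-(p / d)) := by
          rw [Finset.prod_const, Finset.card_univ, Fintype.card_fin, ← Real.rpow_natCast,
            ← Real.rpow_mul (by positivity)]
          congr 1; field_simp
      _ ≤ _ := by
          refine Finset.prod_le_prod (fun i _ => by positivity) fun i _ => ?_
          apply Real.rpow_le_rpow_of_nonpos (by positivity)
          · have := natAbs_le_natNorm z i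
            gcongr
          · have : 0 < p / d := by linarith
            linarith
  refine ne_top_of_le_ne_top (b := (∑' k, g k) ^ d)
    (ENNReal.pow_ne_top (tsum_int_rpow_ne_top hs)) ?_
  rw [ENNReal.tsum_eq_iSup_sum]
  refine iSup_le fun s => ?_
  calc ∑ z ∈ s, polyWeight p z ≤ ∑ z ∈ s, ∏ i, g (z i) := Finset.sum_le_sum fun z _ => key z
    _ ≤ _ := by simpa using sum_prod_le_tsum_pow g s

/-- The coupling `J / |z|^α` as an extended nonnegative real. -/
def coupling (J α : ℝ) (z : Zd d) : ENNReal :=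
  ENNReal.ofReal (if z = 0 then 0 else J / ((natNorm z : ℝ) ^ α))

lemma coupling_neg (J α : ℝ) (z : Zd d) : coupling J α (-z) = coupling J α z := by
  simp [coupling, natNorm_neg]

lemma ofReal_Jcoup (J α : ℝ) (x y : Zd d) :
    ENNReal.ofReal (Jcoup d J α x y) = coupling J α (x - y) := by
  simp [Jcoup, coupling, sub_eq_zero, l1_eq_natNorm]

lemma Jcoup_nonneg {J : ℝ} (hJ : 0 ≤ J) (α : ℝ) (x y : Zd d) : 0 ≤ Jcoup d J α x y := by
  unfold Jcoup
  split_ifs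
  · rfl
  · rw [l1_eq_natNorm]
    positivity

/-- The total coupling at distance at least `R`. -/
def couplingTail (d : ℕ) (J α : ℝ) (R : ℕ) : ENNReal :=
  ∑' z : Zd d, if R ≤ natNorm z then coupling J α z else 0

lemma couplingTail_le {J α δ : ℝ} (hJ : 0 ≤ J) (hα : 0 ≤ α) (hδ : 0 ≤ δ) {R : ℕ} (hR : 1 ≤ R) :
    couplingTail d J α R ≤
      ENNReal.ofReal (J * 2 ^ α * (R : ℝ) ^ (-δ)) * ∑' z : Zd d, polyWeight (α - δ) z := by
  rw [← ENNReal.tsum_mul_left]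
  refine ENNReal.tsum_le_tsum fun z => ?_
  split_ifs with h
  · rw [coupling, polyWeight, ← ENNReal.ofReal_mul (by positivity)]
    apply ENNReal.ofReal_le_ofReal
    have hz : z ≠ 0 := by
      rintro rfl
      rw [natNorm_zero] at h; omega
    rw [if_neg hz]
    have h1 : (1 : ℝ) ≤ natNorm z := by exact_mod_cast hR.trans h
    have hR' : (1 : ℝ) ≤ R := by exact_mod_cast hR
    have e1 : ((natNorm z : ℝ) ^ α)⁻¹ ≤ 2 ^ α * (1 + natNorm z : ℝ) ^ (-α) := by
      rw [Real.rpow_neg (by positivity), ← div_eq_mul_inv, ← Real.div_rpow (by norm_num)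
        (by positivity), ← Real.inv_rpow (by positivity)]
      apply Real.rpow_le_rpow (by positivity) _ hα
      rw [inv_eq_one_div, div_le_div_iff₀ (by positivity) (by positivity)]
      linarith
    have e2 : (1 + natNorm z : ℝ) ^ (-α) ≤ (R : ℝ) ^ (-δ) * (1 + natNorm z : ℝ) ^ (-(α - δ)) := by
      have : (1 + natNorm z : ℝ) ^ (-α)
          = (1 + natNorm z : ℝ) ^ (-δ) * (1 + natNorm z : ℝ) ^ (-(α - δ)) := by
        rw [← Real.rpow_add (by positivity)]; congr 1; ring
      rw [this]
      refine mul_le_mul_of_nonneg_right ?_ (by positivity)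
      apply Real.rpow_le_rpow_of_nonpos (by positivity) _ (by linarith)
      have : (R : ℝ) ≤ natNorm z := by exact_mod_cast h
      linarith
    calc J / (natNorm z : ℝ) ^ α = J * ((natNorm z : ℝ) ^ α)⁻¹ := div_eq_mul_inv _ _
      _ ≤ J * (2 ^ α * ((R : ℝ) ^ (-δ) * (1 + natNorm z : ℝ) ^ (-(α - δ)))) := by
          refine mul_le_mul_of_nonneg_left (e1.trans ?_) hJ
          exact mul_le_mul_of_nonneg_left e2 (by positivity)
      _ = _ := by ring
  · exact bot_le

lemma tsum_coupling_ne_top {J α : ℝ} (hd : 0 < d) (hJ : 0 ≤ J) (hα : (d : ℝ) < α) :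
    ∑' z : Zd d, coupling J α z ≠ ⊤ := by
  have h0 : (0 : ℝ) ≤ d := by positivity
  have h := couplingTail_le (d := d) (R := 1) (δ := 0) hJ (by linarith : 0 ≤ α) le_rfl le_rfl
  have h2 : ∑' z : Zd d, coupling J α z = couplingTail d J α 1 := by
    refine tsum_congr fun z => ?_
    split_ifs with h
    · rfl
    · have : z = 0 := natNorm_eq_zero.1 (by omega)
      simp [coupling, this]
  rw [h2]
  refine ne_top_of_le_ne_top (ENNReal.mul_ne_top ENNReal.ofReal_ne_top ?_) h
  exact tsum_polyWeight_ne_top hd (by simpa using hα)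

/-- Doubling the distance loses at most a factor `2 ^ α`. -/
lemma coupling_le_two_rpow_mul {J α : ℝ} (hJ : 0 ≤ J) (hα : 0 ≤ α) {z w : Zd d} (hw : w ≠ 0)
    (h : natNorm w ≤ 2 * natNorm z) :
    coupling J α z ≤ ENNReal.ofReal (2 ^ α) * coupling J α w := by
  rw [coupling, coupling, ← ENNReal.ofReal_mul (by positivity), if_neg hw]
  apply ENNReal.ofReal_le_ofReal
  split_ifs with hz
  · positivity
  · have hz' : (0 : ℝ) < natNorm z := by
      have := mt natNorm_eq_zero.1 hz
      exact_mod_cast Nat.pos_of_ne_zero this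
    have hw' : (0 : ℝ) < natNorm w := by
      have := mt natNorm_eq_zero.1 hw
      exact_mod_cast Nat.pos_of_ne_zero this
    have h' : (natNorm w : ℝ) ≤ 2 * natNorm z := by exact_mod_cast h
    have := Real.rpow_le_rpow hw'.le h' hα
    rw [Real.mul_rpow (by norm_num) hz'.le] at this
    rw [mul_div_assoc', div_le_div_iff₀ (by positivity) (by positivity)]
    nlinarith
end Norm

/-- The gradient of `τ` lives on nearest-neighbour edges with both ends in `γ`. -/
def GradientIn {d q : ℕ} (τ : Zd d → ZMod q) (γ : Finset (Zd d)) : Prop :=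
  ∀ (x : Zd d) (i : Fin d), τ x ≠ τ (x + Pi.single i 1) → x ∈ γ ∧ x + Pi.single i 1 ∈ γ

/-- `τ` is a potential with gradient in `γ` whose support is controlled by two coordinate
projections of `γ`. -/
structure IsPotential {d q : ℕ} (i₀ : Fin d) (τ : Zd d → ZMod q) (γ : Finset (Zd d)) : Prop where
  gradient : GradientIn τ γ
  line : ∀ x, τ x ≠ 0 → ∃ p ∈ γ, ∀ j ≠ i₀, p j = x j
  slice : ∀ x, τ x ≠ 0 → ∃ p ∈ γ, p i₀ = x i₀

section Potential
variable {d q : ℕ} {τ : Zd d → ZMod q} {γ : Finset (Zd d)} {i₀ : Fin d}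

/-- A geodesic between two points where `τ` differs meets `γ`. -/
lemma GradientIn.exists_mem_near (h : GradientIn τ γ) {x y : Zd d} (hxy : τ x ≠ τ y) :
    ∃ p ∈ γ, natNorm (x - p) ≤ natNorm (x - y) := by
  induction hn : natNorm (x - y) using Nat.strong_induction_on generalizing y with
  | _ n ih =>
    have hne : x - y ≠ 0 := fun h0 => hxy (by rw [sub_eq_zero.1 h0])
    obtain ⟨j, hj⟩ : ∃ j, (x - y) j ≠ 0 := by
      by_contra hcon
      push Not at hcon
      exact hne (funext hcon)
    obtain ⟨y', hy'n, hy'⟩ : ∃ y' : Zd d, natNorm (x - y') + 1 = natNorm (x - y) ∧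
        (τ y ≠ τ y' → y ∈ γ) := by
      have aux : ∀ c : ℤ, ((x - y) j - c).natAbs + 1 = ((x - y) j).natAbs →
          natNorm (x - (y + (Pi.single j c : Zd d))) + 1 = natNorm (x - y) := by
        intro c hc
        rw [natNorm, natNorm, ← Finset.add_sum_erase _ _ (Finset.mem_univ j),
          ← Finset.add_sum_erase _ (fun i => ((x - y) i).natAbs) (Finset.mem_univ j)]
        have e : ∑ i ∈ Finset.univ.erase j, ((x - (y + (Pi.single j c : Zd d))) i).natAbs
            = ∑ i ∈ Finset.univ.erase j, ((x - y) i).natAbs := by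
          refine Finset.sum_congr rfl fun i hi => ?_
          simp [(Finset.mem_erase.1 hi).1]
        rw [e]
        have : (x - (y + (Pi.single j c : Zd d))) j = (x - y) j - c := by simp; ring
        rw [this]
        omega
      rcases lt_or_gt_of_ne hj with hneg | hpos
      · refine ⟨y + Pi.single j (-1), aux (-1) (by omega), fun hd => ?_⟩
        have e : y + Pi.single j (-1) + Pi.single j 1 = y := by
          rw [add_assoc, ← Pi.single_add]; simp
        have := h (y + Pi.single j (-1)) j (by rw [e]; exact hd.symm)
        rw [e] at this
        exact this.2
      · exact ⟨y + Pi.single j 1, aux 1 (by omega), fun hd => (h y j hd).1⟩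
    by_cases hd : τ y = τ y'
    · obtain ⟨p, hp, hpn⟩ := ih _ (by omega) (hd ▸ hxy) rfl
      exact ⟨p, hp, by omega⟩
    · exact ⟨y, hy' hd, hn.le⟩

lemma IsPotential.exists_support (h : IsPotential i₀ τ γ) :
    ∃ A : Finset (Zd d), (∀ x, x ∈ A ↔ τ x ≠ 0) ∧ A.card ≤ γ.card ^ 2 := by
  let B : Finset (Zd d) := (γ ×ˢ γ).image fun p => Function.update p.1 i₀ (p.2 i₀)
  refine ⟨B.filter fun x => τ x ≠ 0, fun x => ?_, ?_⟩
  · simp only [Finset.mem_filter, and_iff_right_iff_imp]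
    intro hx
    obtain ⟨p, hp, hpx⟩ := h.line x hx
    obtain ⟨p', hp', hpx'⟩ := h.slice x hx
    refine Finset.mem_image.2 ⟨(p, p'), Finset.mem_product.2 ⟨hp, hp'⟩, ?_⟩
    ext j
    by_cases hj : j = i₀
    · subst hj; simpa using hpx'
    · simpa [hj] using hpx j hj
  · calc _ ≤ B.card := Finset.card_filter_le _ _
      _ ≤ (γ ×ˢ γ).card := Finset.card_image_le
      _ = _ := by rw [Finset.card_product, sq]

/-- Every point of the support of `τ` is within distance `|γ|²` of `γ`. -/
lemma IsPotential.exists_mem_near (h : IsPotential i₀ τ γ) {x : Zd d} (hx : τ x ≠ 0) :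
    ∃ p ∈ γ, natNorm (x - p) ≤ γ.card ^ 2 := by
  obtain ⟨A, hA, hcard⟩ := h.exists_support
  by_contra hcon
  push Not at hcon
  have key : ∀ k ∈ Finset.range (γ.card ^ 2 + 1), x + Pi.single i₀ (k : ℤ) ∈ A := by
    intro k hk
    rw [Finset.mem_range] at hk
    rw [hA]
    by_contra h0
    obtain ⟨p, hp, hpn⟩ := h.gradient.exists_mem_near (x := x) (y := x + Pi.single i₀ (k : ℤ))
      (by rw [h0]; exact hx)
    have := hcon p hp
    rw [natNorm_sub_comm x (x + _), add_sub_cancel_left, natNorm_single] at hpn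
    omega
  have := Finset.card_le_card_of_injOn (s := Finset.range (γ.card ^ 2 + 1)) (t := A)
    (fun k : ℕ => x + Pi.single i₀ (k : ℤ)) (fun k hk => key k hk) (by
      intro k _ l _ hkl
      have := congrFun hkl i₀
      simpa using this)
  rw [Finset.card_range] at this
  omega

/-- A function invariant under a unit translation and vanishing far out is zero. -/
lemma eq_zero_of_translate_eq {R : Type*} [Zero R] {f : Zd d → R} {i : Fin d}
    (h : ∀ x, f x = f (x + Pi.single i 1)) (h0 : ∀ x, ∃ t : ℕ, f (x + (Pi.single i (t : ℤ) : Zd d)) = 0)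
    (x : Zd d) : f x = 0 := by
  have : ∀ t : ℕ, f x = f (x + (Pi.single i (t : ℤ) : Zd d)) := by
    intro t
    induction t with
    | zero => simp
    | succ t ih =>
      rw [ih, h, add_assoc, ← Pi.single_add]
      push_cast
      rfl
  obtain ⟨t, ht⟩ := h0 x
  rw [this t, ht]

lemma exists_forall_lt (S : Finset (Zd d)) (i : Fin d) (x : Zd d) :
    ∃ t : ℕ, ∀ p ∈ S, p i < x i + t := by
  refine ⟨S.sup fun p => (p i - x i + 1).toNat, fun p hp => ?_⟩
  have := Finset.le_sup (f := fun p : Zd d => (p i - x i + 1).toNat) hp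
  omega

/-- The potential obtained by integrating the part of the gradient of `σ` in `γ` along rays in
direction `i₀`. -/
def rayPotential (i₀ : Fin d) (σ : Zd d → ZMod q) (γ : Finset (Zd d)) (x : Zd d) : ZMod q :=
  ∑ p ∈ γ, if x i₀ ≤ p i₀ ∧ ∀ j ≠ i₀, p j = x j then σ p - σ (p + Pi.single i₀ 1) else 0

lemma rayPotential_sub (i₀ : Fin d) (σ : Zd d → ZMod q) (γ : Finset (Zd d)) (x : Zd d) :
    rayPotential i₀ σ γ x - rayPotential i₀ σ γ (x + Pi.single i₀ 1) =
      if x ∈ γ then σ x - σ (x + Pi.single i₀ 1) else 0 := by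
  rw [rayPotential, rayPotential, ← Finset.sum_sub_distrib]
  trans ∑ p ∈ γ, if x = p then σ p - σ (p + Pi.single i₀ 1) else 0
  swap
  · simp
  refine Finset.sum_congr rfl fun p _ => ?_
  have h2 : (∀ j ≠ i₀, p j = (x + Pi.single i₀ 1 : Zd d) j) ↔ ∀ j ≠ i₀, p j = x j := by
    refine forall₂_congr fun j hj => ?_
    simp [hj]
  have h3 : (x + Pi.single i₀ 1 : Zd d) i₀ = x i₀ + 1 := by simp
  simp only [h2, h3]
  by_cases hline : ∀ j ≠ i₀, p j = x j
  · by_cases hxp : x = p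
    · subst hxp
      simp
    · have hne : p i₀ ≠ x i₀ := by
        intro he
        apply hxp
        ext j
        by_cases hj : j = i₀
        · rw [hj, he]
        · exact (hline j hj).symm
      have : x i₀ ≤ p i₀ ↔ x i₀ + 1 ≤ p i₀ := by omega
      simp only [this, sub_self, if_neg hxp]
  · have hxp : x ≠ p := by
      rintro rfl
      exact hline fun _ _ => rfl
    simp [hline, hxp]

lemma rayPotential_eq_zero_of_forall_lt {σ : Zd d → ZMod q} {x : Zd d}
    (h : ∀ p ∈ γ, p i₀ < x i₀) : rayPotential i₀ σ γ x = 0 := by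
  refine Finset.sum_eq_zero fun p hp => if_neg fun hc => ?_
  have := h p hp
  omega

/-- `S` is the finite set of points having a neighbour with a different spin. -/
def IsBoundary (σ : Zd d → ZMod q) (S : Finset (Zd d)) : Prop :=
  ∀ x, x ∈ S ↔ ∃ y, natNorm (x - y) = 1 ∧ σ x ≠ σ y

lemma IsBoundary.mem_and_mem {σ : Zd d → ZMod q} {S : Finset (Zd d)} (hS : IsBoundary σ S)
    {x : Zd d} {i : Fin d} (h : σ x ≠ σ (x + Pi.single i 1)) :
    x ∈ S ∧ x + Pi.single i 1 ∈ S := by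
  refine ⟨(hS _).2 ⟨_, ?_, h⟩, (hS _).2 ⟨x, ?_, h.symm⟩⟩
  · rw [natNorm_sub_comm, add_sub_cancel_left, natNorm_single]; rfl
  · rw [add_sub_cancel_left, natNorm_single]; rfl

lemma rayPotential_sub_single {σ : Zd d → ZMod q} {S : Finset (Zd d)} (hS : IsBoundary σ S)
    (hγ : ∀ x ∈ S, ∀ y ∈ S, natNorm (x - y) ≤ 2 → x ∈ γ → y ∈ γ) (x : Zd d) (j : Fin d) :
    rayPotential i₀ σ γ x - rayPotential i₀ σ γ (x + Pi.single j 1) =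
      if x ∈ γ then σ x - σ (x + Pi.single j 1) else 0 := by
  by_cases hj : j = i₀
  · subst hj; exact rayPotential_sub _ _ _ _
  set e : Zd d := Pi.single j 1 with he
  set u : Zd d := Pi.single i₀ 1 with hu
  let Δ : Zd d → ZMod q := fun x => rayPotential i₀ σ γ x - rayPotential i₀ σ γ (x + e) -
      if x ∈ γ then σ x - σ (x + e) else 0
  suffices h : Δ x = 0 from sub_eq_zero.1 h
  refine eq_zero_of_translate_eq (i := i₀) (f := Δ) (fun x => ?_) (fun x => ?_) x
  · have h1 := rayPotential_sub i₀ σ γ x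
    have h2 := rayPotential_sub i₀ σ γ (x + e)
    rw [← hu] at h1 h2
    have hcomm : x + e + u = x + u + e := by abel
    rw [hcomm] at h2
    have na : natNorm u = 1 := by rw [hu, natNorm_single]; rfl
    have nb : natNorm e = 1 := by rw [he, natNorm_single]; rfl
    have nc : natNorm (u + e) ≤ 2 := by have := natNorm_add_le u e; omega
    have nd : natNorm (u - e) ≤ 2 := by
      have := natNorm_add_le u (-e)
      rw [natNorm_neg, ← sub_eq_add_neg] at this; omega
    have ne : natNorm (e - u) ≤ 2 := by rw [natNorm_sub_comm]; exact nd
    have s1 : σ x ≠ σ (x + u) → x ∈ S ∧ x + u ∈ S := fun h => hS.mem_and_mem h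
    have s2 : σ x ≠ σ (x + e) → x ∈ S ∧ x + e ∈ S := fun h => hS.mem_and_mem h
    have s3 : σ (x + u) ≠ σ (x + u + e) → x + u ∈ S ∧ x + u + e ∈ S := fun h => hS.mem_and_mem h
    have s4 : σ (x + e) ≠ σ (x + u + e) → x + e ∈ S ∧ x + u + e ∈ S := by
      rw [← hcomm]; exact fun h => hS.mem_and_mem h
    have cl : ∀ y z w : Zd d, z - y = w → natNorm w ≤ 2 → y ∈ S → z ∈ S → (y ∈ γ ↔ z ∈ γ) := by
      intro y z w hw hn hy hz
      refine ⟨hγ y hy z hz ?_, hγ z hz y hy ?_⟩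
      · rw [natNorm_sub_comm, hw]; exact hn
      · rw [hw]; exact hn
    have c1 := cl x (x + u) u (by abel) (by omega)
    have c2 := cl x (x + e) e (by abel) (by omega)
    have c3 := cl x (x + u + e) (u + e) (by abel) nc
    have c4 := cl (x + u) (x + e) (e - u) (by abel) ne
    have c5 := cl (x + u) (x + u + e) e (by abel) (by omega)
    have c6 := cl (x + e) (x + u + e) u (by abel) (by omega)
    have goal' : (if x ∈ γ then σ x - σ (x + u) else 0)
        - (if x + e ∈ γ then σ (x + e) - σ (x + u + e) else 0)
        - (if x ∈ γ then σ x - σ (x + e) else 0)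
        + (if x + u ∈ γ then σ (x + u) - σ (x + u + e) else 0) = 0 := by
      by_cases hex : ∃ y ∈ ({x, x + u, x + e, x + u + e} : Finset (Zd d)), y ∈ S ∧ y ∈ γ
      · have hall : ∀ z ∈ ({x, x + u, x + e, x + u + e} : Finset (Zd d)), z ∈ S → z ∈ γ := by
          obtain ⟨y, hy, hyS, hyγ⟩ := hex
          intro z hz hzS
          simp only [Finset.mem_insert, Finset.mem_singleton] at hy hz
          rcases hy with rfl | rfl | rfl | rfl <;> rcases hz with rfl | rfl | rfl | rfl <;>
            first
            | assumption
            | simp_all only [true_iff, iff_true, forall_const]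
        have full : ∀ (y a b : Zd d), y ∈ ({x, x + u, x + e, x + u + e} : Finset (Zd d)) →
            (σ a ≠ σ b → y ∈ S) → (if y ∈ γ then σ a - σ b else 0) = σ a - σ b := by
          intro y a b hy h
          by_cases hab : σ a = σ b
          · simp [hab]
          · rw [if_pos (hall y hy (h hab))]
        rw [full x x (x + u) (by simp) fun h => (s1 h).1,
          full (x + e) (x + e) (x + u + e) (by simp) fun h => (s4 h).1,
          full x x (x + e) (by simp) fun h => (s2 h).1,
          full (x + u) (x + u) (x + u + e) (by simp) fun h => (s3 h).1]
        ring
      · push Not at hex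
        have none : ∀ (y a b : Zd d), y ∈ ({x, x + u, x + e, x + u + e} : Finset (Zd d)) →
            (σ a ≠ σ b → y ∈ S) → (if y ∈ γ then σ a - σ b else 0) = 0 := by
          intro y a b hy h
          by_cases hab : σ a = σ b
          · simp [hab]
          · rw [if_neg (hex y hy (h hab))]
        rw [none x x (x + u) (by simp) fun h => (s1 h).1,
          none (x + e) (x + e) (x + u + e) (by simp) fun h => (s4 h).1,
          none x x (x + e) (by simp) fun h => (s2 h).1,
          none (x + u) (x + u) (x + u + e) (by simp) fun h => (s3 h).1]
        ring
    simp only [Δ]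
    linear_combination goal' + h1 - h2
  · obtain ⟨t, ht⟩ := exists_forall_lt γ i₀ x
    have h1 : ∀ p ∈ γ, p i₀ < (x + Pi.single i₀ (t : ℤ) : Zd d) i₀ := by simpa using ht
    have h2 : ∀ p ∈ γ, p i₀ < (x + Pi.single i₀ (t : ℤ) + e : Zd d) i₀ := by
      have : e i₀ = 0 := by simp [he, Ne.symm hj]
      simpa [this] using ht
    refine ⟨t, ?_⟩
    simp only [Δ]
    rw [rayPotential_eq_zero_of_forall_lt h1, rayPotential_eq_zero_of_forall_lt h2,
      if_neg fun hm => (h1 _ hm).false]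
    simp

lemma isPotential_rayPotential {σ : Zd d → ZMod q} {S : Finset (Zd d)} (hS : IsBoundary σ S)
    (hγ : ∀ x ∈ S, ∀ y ∈ S, natNorm (x - y) ≤ 2 → x ∈ γ → y ∈ γ) {i₁ : Fin d} (hi : i₁ ≠ i₀) :
    IsPotential i₀ (rayPotential i₀ σ γ) γ := by
  have grad : GradientIn (rayPotential i₀ σ γ) γ := by
    intro x i h
    have hs := rayPotential_sub_single (i₀ := i₀) hS hγ x i
    by_cases hx : x ∈ γ
    · refine ⟨hx, ?_⟩
      rw [if_pos hx] at hs
      have hne : σ x ≠ σ (x + Pi.single i 1) := by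
        intro h0
        rw [h0, sub_self, sub_eq_zero] at hs
        exact h hs
      have hm := hS.mem_and_mem hne
      refine hγ _ hm.1 _ hm.2 ?_ hx
      rw [natNorm_sub_comm, add_sub_cancel_left, natNorm_single]
      simp
    · rw [if_neg hx, sub_eq_zero] at hs
      exact absurd hs h
  have line : ∀ x, rayPotential i₀ σ γ x ≠ 0 → ∃ p ∈ γ, ∀ j ≠ i₀, p j = x j := by
    intro x hx
    obtain ⟨p, hp, hne⟩ := Finset.exists_ne_zero_of_sum_ne_zero hx
    have := (ite_ne_right_iff.1 hne).1
    exact ⟨p, hp, this.2⟩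
  refine ⟨grad, line, fun x hx => ?_⟩
  obtain ⟨t, ht⟩ := exists_forall_lt γ i₁ x
  have h0 : rayPotential i₀ σ γ (x + Pi.single i₁ (t : ℤ)) = 0 := by
    by_contra hne
    obtain ⟨p, hp, hpe⟩ := line _ hne
    have h1 := hpe i₁ hi
    have h2 := ht p hp
    simp at h1
    omega
  by_contra hcon
  push Not at hcon
  have step : ∀ k : ℕ, rayPotential i₀ σ γ (x + Pi.single i₁ (k : ℤ)) = rayPotential i₀ σ γ x := by
    intro k
    induction k with
    | zero => simp
    | succ k ih =>
      rw [← ih]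
      by_contra hne
      have e : (x + Pi.single i₁ (k : ℤ) + Pi.single i₁ 1 : Zd d)
          = x + Pi.single i₁ ((k + 1 : ℕ) : ℤ) := by
        rw [add_assoc, ← Pi.single_add]; push_cast; rfl
      have := (grad (x + Pi.single i₁ (k : ℤ)) i₁ (by rw [e]; exact Ne.symm hne)).1
      refine hcon _ this ?_
      simp [Ne.symm hi]
  exact hx ((step t).symm.trans h0)

lemma rayPotential_boundary {σ : Zd d → ZMod q} {S Λ : Finset (Zd d)} (hS : IsBoundary σ S)
    {r : ZMod q} (hr : ∀ x, x ∉ Λ → σ x = r) (x : Zd d) : rayPotential i₀ σ S x = σ x - r := by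
  refine sub_eq_zero.1 (eq_zero_of_translate_eq (i := i₀)
    (f := fun x => rayPotential i₀ σ S x - (σ x - r)) (fun x => ?_) (fun x => ?_) x)
  · have h := rayPotential_sub i₀ σ S x
    have : (if x ∈ S then σ x - σ (x + Pi.single i₀ 1) else 0) = σ x - σ (x + Pi.single i₀ 1) := by
      by_cases hab : σ x = σ (x + Pi.single i₀ 1)
      · simp [← hab]
      · rw [if_pos (hS.mem_and_mem hab).1]
    rw [this] at h
    linear_combination h
  · obtain ⟨t, ht⟩ := exists_forall_lt (S ∪ Λ) i₀ x
    refine ⟨t, ?_⟩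
    have h1 : ∀ p ∈ S ∪ Λ, p i₀ < (x + Pi.single i₀ (t : ℤ) : Zd d) i₀ := by simpa using ht
    rw [rayPotential_eq_zero_of_forall_lt fun p hp => h1 p (Finset.mem_union_left _ hp),
      hr _ fun hm => (h1 _ (Finset.mem_union_right _ hm)).false]
    simp

lemma exists_isBoundary {σ : Zd d → ZMod q} {Λ : Finset (Zd d)} {r : ZMod q}
    (hr : ∀ x, x ∉ Λ → σ x = r) : ∃ S, IsBoundary σ S := by
  have hfin : {x : Zd d | ∃ y, natNorm (x - y) = 1 ∧ σ x ≠ σ y}.Finite := by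
    let T : Finset (Zd d) := Fintype.piFinset fun _ => Finset.Icc (-1 : ℤ) 1
    refine Set.Finite.subset (Finset.finite_toSet (Λ ∪ (Λ ×ˢ T).image fun p => p.1 + p.2)) ?_
    rintro x ⟨y, hn, hne⟩
    by_cases hx : x ∈ Λ
    · simp [hx]
    · have hy : y ∈ Λ := by
        by_contra hy
        exact hne (by rw [hr x hx, hr y hy])
      refine Finset.mem_coe.2 (Finset.mem_union_right _ (Finset.mem_image.2
        ⟨(y, x - y), Finset.mem_product.2 ⟨hy, ?_⟩, by simp⟩))
      refine Fintype.mem_piFinset.2 fun i => ?_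
      have := natAbs_le_natNorm (x - y) i
      rw [Finset.mem_Icc]
      simp only at this ⊢
      omega
  exact ⟨hfin.toFinset, fun x => by simp⟩

end Potential

/-- Clusters: sets obtained from singletons by repeatedly merging disjoint clusters whose distance
is polynomially small in the size of the smaller one. -/
inductive IsCluster {d : ℕ} (M a : ℕ) : Finset (Zd d) → Prop
  | single (x : Zd d) : IsCluster M a {x}
  | merge {s t : Finset (Zd d)} {x y : Zd d} (hs : IsCluster M a s) (ht : IsCluster M a t)
      (hst : Disjoint s t) (hx : x ∈ s) (hy : y ∈ t)
      (hxy : natNorm (x - y) ≤ M * (min s.card t.card) ^ a) : IsCluster M a (s ∪ t)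

section Cluster
variable {d : ℕ} {M a : ℕ}

lemma IsCluster.nonempty {γ : Finset (Zd d)} (h : IsCluster M a γ) : γ.Nonempty := by
  induction h with
  | single x => exact Finset.singleton_nonempty x
  | merge _ _ _ hx _ _ => exact ⟨_, Finset.mem_union_left _ hx⟩

/-- Every finite set splits into well separated clusters. -/
lemma exists_cluster_partition (M a : ℕ) (S : Finset (Zd d)) :
    ∃ P : Finset (Finset (Zd d)), (∀ γ ∈ P, IsCluster M a γ) ∧
      ((P : Set (Finset (Zd d))).PairwiseDisjoint id) ∧ P.biUnion id = S ∧
      ∀ γ ∈ P, ∀ γ' ∈ P, γ ≠ γ' → ∀ x ∈ γ, ∀ y ∈ γ',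
        M * (min γ.card γ'.card) ^ a < natNorm (x - y) := by
  let Good : Finset (Finset (Zd d)) → Prop := fun P => (∀ γ ∈ P, IsCluster M a γ) ∧
      ((P : Set (Finset (Zd d))).PairwiseDisjoint id) ∧ P.biUnion id = S
  have hex : ∃ n P, Good P ∧ P.card = n := by
    refine ⟨_, S.image fun x => {x}, ⟨?_, ?_, ?_⟩, rfl⟩
    · intro γ hγ
      obtain ⟨x, -, rfl⟩ := Finset.mem_image.1 hγ
      exact .single x
    · intro γ hγ γ' hγ' hne
      obtain ⟨x, -, rfl⟩ := Finset.mem_image.1 (Finset.mem_coe.1 hγ)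
      obtain ⟨y, -, rfl⟩ := Finset.mem_image.1 (Finset.mem_coe.1 hγ')
      simp only [Function.onFun, id, Finset.disjoint_singleton]
      rintro rfl
      exact hne rfl
    · ext x
      simp
  classical
  obtain ⟨P, ⟨hP1, hP2, hP3⟩, hPc⟩ := Nat.find_spec hex
  have hmin := fun m => Nat.find_min hex (m := m)
  refine ⟨P, hP1, hP2, hP3, fun γ hγ γ' hγ' hne x hx y hy => ?_⟩
  by_contra hcon
  push Not at hcon
  have hdisj : Disjoint γ γ' := hP2 hγ hγ' hne
  have hγ'e : γ' ∈ P.erase γ := Finset.mem_erase.2 ⟨hne.symm, hγ'⟩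
  let Q := (P.erase γ).erase γ'
  have hQ : ∀ s ∈ Q, s ∈ P ∧ s ≠ γ ∧ s ≠ γ' := by
    intro s hs
    simp only [Q, Finset.mem_erase] at hs
    exact ⟨hs.2.2, hs.2.1, hs.1⟩
  have hQd : ∀ s ∈ Q, Disjoint s (γ ∪ γ') := by
    intro s hs
    obtain ⟨h1, h2, h3⟩ := hQ s hs
    exact Finset.disjoint_union_right.2 ⟨hP2 h1 hγ h2, hP2 h1 hγ' h3⟩
  refine hmin (insert (γ ∪ γ') Q).card ?_ ⟨insert (γ ∪ γ') Q, ⟨?_, ?_, ?_⟩, rfl⟩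
  · have c1 := Finset.card_erase_add_one hγ
    have c2 := Finset.card_erase_add_one hγ'e
    have c3 := Finset.card_insert_le (γ ∪ γ') Q
    simp only [Q] at c3 ⊢
    omega
  · intro s hs
    rcases Finset.mem_insert.1 hs with rfl | hs
    · exact .merge (hP1 γ hγ) (hP1 γ' hγ') hdisj hx hy hcon
    · exact hP1 s (hQ s hs).1
  · intro s hs t ht hst
    rcases Finset.mem_insert.1 (Finset.mem_coe.1 hs) with rfl | hs <;>
      rcases Finset.mem_insert.1 (Finset.mem_coe.1 ht) with rfl | ht
    · exact absurd rfl hst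
    · exact (hQd t ht).symm
    · exact hQd s hs
    · exact hP2 (hQ s hs).1 (hQ t ht).1 hst
  · rw [Finset.biUnion_insert, ← hP3]
    conv_rhs => rw [← Finset.insert_erase hγ, ← Finset.insert_erase hγ'e]
    rw [Finset.biUnion_insert, Finset.biUnion_insert]
    simp [Q, Finset.union_assoc]

/-- The points visited by the walk from `x` with the given steps, the starting point excluded. -/
def visited : Zd d → List (Zd d) → Finset (Zd d)
  | _, [] => ∅
  | x, v :: l => insert (x + v) (visited (x + v) l)

lemma visited_append (x : Zd d) (l₁ l₂ : List (Zd d)) :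
    visited x (l₁ ++ l₂) = visited x l₁ ∪ visited (x + l₁.sum) l₂ := by
  induction l₁ generalizing x with
  | nil => simp [visited]
  | cons v l ih => simp [visited, ih, add_assoc]

lemma exists_split_of_mem_visited {x y : Zd d} {l : List (Zd d)} (h : y ∈ insert x (visited x l)) :
    ∃ l₁ l₂, l = l₁ ++ l₂ ∧ x + l₁.sum = y := by
  induction l generalizing x with
  | nil => exact ⟨[], [], rfl, by simpa [visited, eq_comm] using h⟩
  | cons v l ih =>
    rcases Finset.mem_insert.1 h with rfl | h
    · exact ⟨[], _, rfl, by simp⟩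
    · obtain ⟨l₁, l₂, rfl, he⟩ := ih h
      exact ⟨v :: l₁, l₂, rfl, by rw [List.sum_cons, ← add_assoc, he]⟩

/-- The product of `1 + |v|` over the steps `v` of a walk. -/
def stepProd (l : List (Zd d)) : ℕ := (l.map fun v => 1 + natNorm v).prod

/-- A cluster of size `n` is the range of a closed walk with `2 (n - 1)` steps whose step lengths
have an exponentially bounded product. -/
lemma IsCluster.exists_walk (hM : 1 ≤ M) {γ : Finset (Zd d)} (h : IsCluster M a γ) :
    ∀ x ∈ γ, ∃ l : List (Zd d), l.sum = 0 ∧ l.length + 2 = 2 * γ.card ∧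
      insert x (visited x l) = γ ∧
      stepProd l * γ.card ^ (2 * a) * (2 * M * 2 ^ a) ^ 2 ≤ (2 * M * 2 ^ a) ^ (2 * γ.card) := by
  have splice : ∀ (s t : Finset (Zd d)) (x y : Zd d), Disjoint s t → y ∈ t → x ∈ s →
      natNorm (x - y) ≤ M * (min s.card t.card) ^ a →
      (∀ x ∈ s, ∃ l : List (Zd d), l.sum = 0 ∧ l.length + 2 = 2 * s.card ∧
        insert x (visited x l) = s ∧
        stepProd l * s.card ^ (2 * a) * (2 * M * 2 ^ a) ^ 2 ≤ (2 * M * 2 ^ a) ^ (2 * s.card)) →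
      (∀ x ∈ t, ∃ l : List (Zd d), l.sum = 0 ∧ l.length + 2 = 2 * t.card ∧
        insert x (visited x l) = t ∧
        stepProd l * t.card ^ (2 * a) * (2 * M * 2 ^ a) ^ 2 ≤ (2 * M * 2 ^ a) ^ (2 * t.card)) →
      ∀ z ∈ s, ∃ l : List (Zd d), l.sum = 0 ∧ l.length + 2 = 2 * (s ∪ t).card ∧
        insert z (visited z l) = s ∪ t ∧
        stepProd l * (s ∪ t).card ^ (2 * a) * (2 * M * 2 ^ a) ^ 2
          ≤ (2 * M * 2 ^ a) ^ (2 * (s ∪ t).card) := by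
    intro s t x y hst hy hx hxy hs ht z hz
    obtain ⟨l, hl0, hln, hlv, hlp⟩ := hs z hz
    obtain ⟨m, hm0, hmn, hmv, hmp⟩ := ht y hy
    obtain ⟨l₁, l₂, rfl, hsum⟩ := exists_split_of_mem_visited (l := l) (hlv ▸ hx)
    have hcard : (s ∪ t).card = s.card + t.card := Finset.card_union_of_disjoint hst
    refine ⟨l₁ ++ ((y - x) :: (m ++ ((x - y) :: l₂))), ?_, ?_, ?_, ?_⟩
    · rw [List.sum_append] at hl0
      simp only [List.sum_append, List.sum_cons, hm0, zero_add]
      rw [← hl0]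
      abel
    · simp only [List.length_append, List.length_cons] at hln hmn ⊢
      omega
    · rw [← hlv, ← hmv]
      rw [visited_append, visited_append, hsum]
      simp only [visited, visited_append, add_sub_cancel, hm0, add_zero]
      have hxm : x ∈ insert z (visited z l₁ ∪ visited x l₂) := by
        rw [visited_append, hsum] at hlv
        rw [hlv]; exact hx
      ext w
      simp only [Finset.mem_insert, Finset.mem_union] at hxm ⊢
      constructor
      · rintro (h | h | h | h | h | h)
        · tauto
        · tauto
        · tauto
        · tauto
        · subst h; tauto
        · tauto
      · tauto
    · have hs1 : 1 ≤ s.card := Finset.card_pos.2 ⟨x, hx⟩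
      have ht1 : 1 ≤ t.card := Finset.card_pos.2 ⟨y, hy⟩
      have hprod : stepProd (l₁ ++ ((y - x) :: (m ++ ((x - y) :: l₂))))
          = stepProd (l₁ ++ l₂) * stepProd m * (1 + natNorm (x - y)) ^ 2 := by
        simp only [stepProd, List.map_append, List.map_cons, List.prod_append, List.prod_cons,
          natNorm_sub_comm y x]
        ring
      rw [hprod, hcard]
      have hmin1 : 1 ≤ M * (min s.card t.card) ^ a :=
        Nat.mul_pos hM (pow_pos (by omega) _)
      have hmul : min s.card t.card * (s.card + t.card) ≤ 2 * (s.card * t.card) := by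
        rcases le_total s.card t.card with h | h
        · rw [min_eq_left h]; nlinarith
        · rw [min_eq_right h]; nlinarith
      have key : (1 + natNorm (x - y)) * (s.card + t.card) ^ a
          ≤ (2 * M * 2 ^ a) * (s.card * t.card) ^ a := by
        calc _ ≤ (2 * (M * (min s.card t.card) ^ a)) * (s.card + t.card) ^ a := by
              gcongr; omega
          _ = 2 * M * (min s.card t.card * (s.card + t.card)) ^ a := by rw [mul_pow]; ring
          _ ≤ 2 * M * (2 * (s.card * t.card)) ^ a := by gcongr
          _ = _ := by rw [mul_pow]; ring
      calc _ = (stepProd (l₁ ++ l₂) * stepProd m) *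
              ((1 + natNorm (x - y)) * (s.card + t.card) ^ a) ^ 2 * (2 * M * 2 ^ a) ^ 2 := by
            rw [mul_pow _ _ 2, ← pow_mul, mul_comm a 2]; ring
        _ ≤ (stepProd (l₁ ++ l₂) * stepProd m) *
              ((2 * M * 2 ^ a) * (s.card * t.card) ^ a) ^ 2 * (2 * M * 2 ^ a) ^ 2 := by gcongr
        _ = (stepProd (l₁ ++ l₂) * s.card ^ (2 * a) * (2 * M * 2 ^ a) ^ 2) *
              (stepProd m * t.card ^ (2 * a) * (2 * M * 2 ^ a) ^ 2) := by
            rw [mul_comm 2 a, pow_mul, pow_mul, mul_pow, mul_pow]; ring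
        _ ≤ (2 * M * 2 ^ a) ^ (2 * s.card) * (2 * M * 2 ^ a) ^ (2 * t.card) :=
            Nat.mul_le_mul hlp hmp
        _ = _ := by rw [← pow_add, mul_add]
  induction h with
  | single x =>
    intro y hy
    rw [Finset.mem_singleton] at hy
    subst hy
    exact ⟨[], by simp, by simp, by simp [visited], by simp [stepProd]⟩
  | @merge s t x y hs ht hst hx hy hxy ihs iht =>
    intro z hz
    rcases Finset.mem_union.1 hz with hz | hz
    · exact splice s t x y hst hy hx hxy ihs iht z hz
    · rw [Finset.union_comm]
      refine splice t s y x hst.symm hx hy ?_ iht ihs z hz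
      rwa [natNorm_sub_comm, min_comm]

end Cluster

/-- `E` is a decomposition of the configuration `s` relative to the colour `r` into well separated
clusters carrying potentials. -/
structure Decomp {d q : ℕ} (i₀ : Fin d) (M a : ℕ) (s : Zd d → ZMod q) (r : ZMod q)
    (E : Finset (Finset (Zd d) × (Zd d → ZMod q))) : Prop where
  cluster : ∀ e ∈ E, IsCluster M a e.1
  pot : ∀ e ∈ E, IsPotential i₀ e.2 e.1
  sep : ∀ e ∈ E, ∀ e' ∈ E, e ≠ e' → ∀ p ∈ e.1, ∀ p' ∈ e'.1,
    M * (min e.1.card e'.1.card) ^ a < natNorm (p - p')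
  sum : ∀ x, ∑ e ∈ E, e.2 x = s x - r
  edge : ∀ e ∈ E, ∀ p ∈ e.1, ∃ y, natNorm (p - y) = 1 ∧ e.2 p ≠ e.2 y

section Decomposition
variable {d q : ℕ} {M a : ℕ}

lemma eq_add_single_of_natNorm_sub_eq_one {x y : Zd d} (h : natNorm (x - y) = 1) :
    ∃ i : Fin d, y = x + Pi.single i 1 ∨ x = y + Pi.single i 1 := by
  obtain ⟨i, hi⟩ : ∃ i, (x - y) i ≠ 0 := by
    by_contra hcon
    push Not at hcon
    rw [natNorm_eq_zero.2 (funext hcon)] at h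
    omega
  have hsum : ((x - y) i).natAbs + ∑ j ∈ Finset.univ.erase i, ((x - y) j).natAbs = 1 := by
    rw [Finset.add_sum_erase _ (fun j => ((x - y) j).natAbs) (Finset.mem_univ i)]; exact h
  have h0 : ∀ j ≠ i, (x - y) j = 0 := by
    intro j hj
    have h1 : ∑ j ∈ Finset.univ.erase i, ((x - y) j).natAbs = 0 := by omega
    have := Finset.sum_eq_zero_iff.1 h1 j (by simp [hj])
    omega
  have hi1 : ((x - y) i).natAbs = 1 := by omega
  refine ⟨i, ?_⟩
  rcases Int.natAbs_eq_iff.1 hi1 with hc | hc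
  · right
    ext j
    by_cases hj : j = i
    · subst hj; simp only [Pi.sub_apply] at hc; simp; omega
    · have := h0 j hj; simp only [Pi.sub_apply] at this; simp [hj]; omega
  · left
    ext j
    by_cases hj : j = i
    · subst hj; simp only [Pi.sub_apply] at hc; simp; omega
    · have := h0 j hj; simp only [Pi.sub_apply] at this; simp [hj]; omega

lemma exists_decomp {i₀ i₁ : Fin d} (hi : i₁ ≠ i₀) (hM : 2 ≤ M) {s : Zd d → ZMod q}
    {Λ : Finset (Zd d)} {r : ZMod q} (hr : ∀ x, x ∉ Λ → s x = r) :
    ∃ E, Decomp i₀ M a s r E := by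
  obtain ⟨S, hS⟩ := exists_isBoundary hr
  obtain ⟨P, hPc, hPd, hPu, hPs⟩ := exists_cluster_partition M a S
  have hsub : ∀ γ ∈ P, γ ⊆ S := fun γ hγ => hPu ▸ Finset.subset_biUnion_of_mem id hγ
  have hγ : ∀ γ ∈ P, ∀ x ∈ S, ∀ y ∈ S, natNorm (x - y) ≤ 2 → x ∈ γ → y ∈ γ := by
    intro γ hγ x hx y hy hxy hxγ
    rw [← hPu, Finset.mem_biUnion] at hy
    obtain ⟨γ', hγ', hyγ'⟩ := hy
    by_cases hne : γ = γ'
    · subst hne; exact hyγ'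
    · have h1 := hPs γ hγ γ' hγ' hne x hxγ y hyγ'
      have h2 : 1 ≤ (min γ.card γ'.card) ^ a := by
        have h3 : 0 < min γ.card γ'.card :=
          lt_min (Finset.card_pos.2 ⟨x, hxγ⟩) (Finset.card_pos.2 ⟨y, hyγ'⟩)
        exact Nat.pow_pos h3
      nlinarith
  classical
  let f : Finset (Zd d) → Finset (Zd d) × (Zd d → ZMod q) := fun γ => (γ, rayPotential i₀ s γ)
  refine ⟨P.image f, ?_, ?_, ?_, ?_, ?_⟩
  · intro e he
    obtain ⟨γ, h, rfl⟩ := Finset.mem_image.1 he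
    exact hPc γ h
  · intro e he
    obtain ⟨γ, h, rfl⟩ := Finset.mem_image.1 he
    exact isPotential_rayPotential hS (hγ γ h) hi
  · intro e he e' he' hne
    obtain ⟨γ, h, rfl⟩ := Finset.mem_image.1 he
    obtain ⟨γ', h', rfl⟩ := Finset.mem_image.1 he'
    exact hPs γ h γ' h' (fun hc => hne (by rw [hc]))
  · intro x
    rw [Finset.sum_image (fun γ _ γ' _ h => congrArg Prod.fst h), ← rayPotential_boundary hS hr,
      ← hPu]
    simp only [rayPotential, f]
    rw [Finset.sum_biUnion hPd]
    rfl
  · intro e he p hp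
    obtain ⟨γ, h, rfl⟩ := Finset.mem_image.1 he
    obtain ⟨y, hy, hsy⟩ := (hS p).1 (hsub γ h hp)
    have hyS : y ∈ S := (hS y).2 ⟨p, by rwa [natNorm_sub_comm], hsy.symm⟩
    have hyγ : y ∈ γ := hγ γ h p (hsub γ h hp) y hyS (by omega) hp
    refine ⟨y, hy, ?_⟩
    obtain ⟨i, rfl | rfl⟩ := eq_add_single_of_natNorm_sub_eq_one hy
    · have := rayPotential_sub_single (i₀ := i₀) hS (hγ γ h) p i
      rw [if_pos hp] at this
      exact sub_ne_zero.1 (this ▸ sub_ne_zero.2 hsy)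
    · have := rayPotential_sub_single (i₀ := i₀) hS (hγ γ h) y i
      rw [if_pos hyγ] at this
      exact (sub_ne_zero.1 (this ▸ sub_ne_zero.2 hsy.symm)).symm

end Decomposition

/-- The steps of a walk together with the values of `τ` at the visited points. -/
def walkCode {d q : ℕ} (τ : Zd d → ZMod q) : Zd d → List (Zd d) → List (Zd d × ZMod q)
  | _, [] => []
  | x, v :: l => (v, τ (x + v)) :: walkCode τ (x + v) l

section Counting
variable {d q : ℕ} {M a : ℕ}

lemma walkCode_map_fst (τ : Zd d → ZMod q) (x : Zd d) (l : List (Zd d)) :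
    (walkCode τ x l).map Prod.fst = l := by
  induction l generalizing x with
  | nil => rfl
  | cons v l ih => simp [walkCode, ih]

lemma eq_of_walkCode_eq {τ τ' : Zd d → ZMod q} {x : Zd d} {l : List (Zd d)}
    (h : walkCode τ x l = walkCode τ' x l) : ∀ y ∈ visited x l, τ y = τ' y := by
  induction l generalizing x with
  | nil => simp [visited]
  | cons v l ih =>
    simp only [walkCode, List.cons.injEq, Prod.mk.injEq, true_and] at h
    intro y hy
    rcases Finset.mem_insert.1 hy with rfl | hy
    · exact h.1
    · exact ih h.2 y hy

/-- A potential is determined by its values on the set carrying its gradient. -/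
lemma IsPotential.ext {τ τ' : Zd d → ZMod q} {γ : Finset (Zd d)} {i₀ : Fin d}
    (h : IsPotential i₀ τ γ) (h' : IsPotential i₀ τ' γ) (heq : ∀ y ∈ γ, τ y = τ' y) : τ = τ' := by
  funext x
  refine sub_eq_zero.1 (eq_zero_of_translate_eq (i := i₀) (f := fun x => τ x - τ' x)
    (fun x => ?_) (fun x => ?_) x)
  · by_cases hx : x ∈ γ ∧ x + Pi.single i₀ 1 ∈ γ
    · simp only [heq _ hx.1, heq _ hx.2, sub_self]
    · have h1 : τ x = τ (x + Pi.single i₀ 1) := by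
        by_contra hc; exact hx (h.gradient _ _ hc)
      have h2 : τ' x = τ' (x + Pi.single i₀ 1) := by
        by_contra hc; exact hx (h'.gradient _ _ hc)
      simp only [← h1, ← h2]
  · obtain ⟨t, ht⟩ := exists_forall_lt γ i₀ x
    have key : ∀ υ : Zd d → ZMod q, IsPotential i₀ υ γ →
        υ (x + (Pi.single i₀ (t : ℤ) : Zd d)) = 0 := by
      intro υ hυ
      by_contra hc
      obtain ⟨p, hp, hpx⟩ := hυ.slice _ hc
      have := ht p hp
      simp only [Pi.add_apply, Pi.single_eq_same] at hpx
      omega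
    exact ⟨t, by rw [key τ h, key τ' h', sub_self]⟩

lemma sum_list_prod_le_tsum_pow {β : Type*} (g : β → ENNReal) (L : ℕ) (s : Finset (List β))
    (hs : ∀ l ∈ s, l.length = L) : ∑ l ∈ s, (l.map g).prod ≤ (∑' b, g b) ^ L := by
  classical
  let t : Finset (Fin L → β) := s.preimage List.ofFn List.ofFn_injective.injOn
  have hst : s ⊆ t.image List.ofFn := by
    intro l hl
    have := hs l hl
    subst this
    exact Finset.mem_image.2 ⟨l.get, by simpa [t] using hl, List.ofFn_get l⟩
  calc ∑ l ∈ s, (l.map g).prod ≤ ∑ l ∈ t.image List.ofFn, (l.map g).prod :=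
        Finset.sum_le_sum_of_subset hst
    _ = ∑ h ∈ t, ∏ i, g (h i) := by
        rw [Finset.sum_image List.ofFn_injective.injOn]
        refine Finset.sum_congr rfl fun h _ => ?_
        rw [List.map_ofFn, List.prod_ofFn]
        rfl
    _ ≤ (∑' b, g b) ^ L := by simpa using sum_prod_le_tsum_pow g t

lemma prod_polyWeight {p : ℝ} (l : List (Zd d)) :
    (l.map (polyWeight p)).prod = ENNReal.ofReal ((stepProd l : ℝ) ^ (-p)) := by
  induction l with
  | nil => simp [stepProd]
  | cons v l ih =>
    have : stepProd (v :: l) = (1 + natNorm v) * stepProd l := by simp [stepProd]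
    rw [List.map_cons, List.prod_cons, ih, this, polyWeight, ← ENNReal.ofReal_mul (by positivity)]
    push_cast
    rw [Real.mul_rpow (by positivity) (by positivity)]

/-- The exponential growth rate of the number of clusters with potentials. -/
def growthRate (d q M a : ℕ) (p : ℝ) : ENNReal :=
  ENNReal.ofReal ((4 * (2 * M * 2 ^ a) ^ 2 : ℝ) ^ p) *
    (1 + q * ∑' z : Zd d, polyWeight p z) ^ 2

lemma one_add_sq_le_four_pow (n : ℕ) : 1 + n ^ 2 ≤ 4 ^ n := by
  induction n with
  | zero => simp
  | succ n ih =>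
    have := Nat.le_self_pow two_ne_zero n
    rw [pow_succ 4 n]
    nlinarith

/-- The walk encoding of a cluster with a potential that does not vanish at `x`. -/
lemma exists_walk_from (hM : 1 ≤ M) {i₀ : Fin d} {γ : Finset (Zd d)} {τ : Zd d → ZMod q}
    (hc : IsCluster M a γ) (hp : IsPotential i₀ τ γ) {x : Zd d} (hx : τ x ≠ 0) :
    ∃ l : List (Zd d), l.length + 1 = 2 * γ.card ∧ visited x l = γ ∧
      stepProd l ≤ (4 * (2 * M * 2 ^ a) ^ 2) ^ γ.card := by
  obtain ⟨p, hpγ, hpx⟩ := hp.exists_mem_near hx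
  obtain ⟨l, -, hl, hv, hs⟩ := hc.exists_walk hM p hpγ
  refine ⟨(p - x) :: l, by simp only [List.length_cons]; omega, by simpa [visited] using hv, ?_⟩
  have h1 : 1 ≤ γ.card := Finset.card_pos.2 ⟨p, hpγ⟩
  have h2 : stepProd l ≤ (2 * M * 2 ^ a) ^ (2 * γ.card) := by
    refine le_trans ?_ hs
    rw [mul_assoc]
    exact Nat.le_mul_of_pos_right _ (by positivity)
  have : stepProd ((p - x) :: l) = (1 + natNorm (p - x)) * stepProd l := by simp [stepProd]
  rw [this, mul_pow, ← pow_mul]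
  refine Nat.mul_le_mul (le_trans ?_ (one_add_sq_le_four_pow _)) h2
  rw [natNorm_sub_comm]
  omega

lemma card_le_growthRate_pow [NeZero q] (hM : 1 ≤ M) {p : ℝ} (hp : 0 ≤ p) {i₀ : Fin d}
    {x : Zd d} {n : ℕ}
    {s : Finset (Finset (Zd d) × (Zd d → ZMod q))} (hc : ∀ e ∈ s, IsCluster M a e.1)
    (hpot : ∀ e ∈ s, IsPotential i₀ e.2 e.1) (hx : ∀ e ∈ s, e.2 x ≠ 0)
    (hn : ∀ e ∈ s, e.1.card = n) : (s.card : ENNReal) ≤ growthRate d q M a p ^ n := by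
  classical
  have hex : ∀ e : Finset (Zd d) × (Zd d → ZMod q), ∃ l : List (Zd d), e ∈ s →
      l.length + 1 = 2 * e.1.card ∧ visited x l = e.1 ∧
        stepProd l ≤ (4 * (2 * M * 2 ^ a) ^ 2) ^ e.1.card := by
    intro e
    by_cases he : e ∈ s
    · obtain ⟨l, hl⟩ := exists_walk_from hM (hc e he) (hpot e he) (hx e he)
      exact ⟨l, fun _ => hl⟩
    · exact ⟨[], fun h => absurd h he⟩
  choose f hf using hex
  let c : Finset (Zd d) × (Zd d → ZMod q) → List (Zd d × ZMod q) := fun e => walkCode e.2 x (f e)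
  have hmap : ∀ e, (c e).map Prod.fst = f e := fun e => walkCode_map_fst _ _ _
  have hinj : Set.InjOn c s := by
    intro e he e' he' h
    have h1 : f e = f e' := by rw [← hmap, ← hmap, h]
    have h2 : e.1 = e'.1 := by rw [← (hf e he).2.1, ← (hf e' he').2.1, h1]
    refine Prod.ext h2 ((hpot e he).ext (h2 ▸ hpot e' he') ?_)
    intro y hy
    rw [← (hf e he).2.1] at hy
    refine eq_of_walkCode_eq ?_ y hy
    have h3 : walkCode e.2 x (f e) = walkCode e'.2 x (f e') := h
    rw [h3, h1]
  set D : ℝ := 4 * (2 * M * 2 ^ a) ^ 2 with hD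
  have hM' : (0 : ℝ) < M := by exact_mod_cast hM
  have hDpos : 0 < D := by positivity
  let g : Zd d × ZMod q → ENNReal := fun b => polyWeight p b.1
  have hg : ∑' b, g b = q * ∑' z : Zd d, polyWeight p z := by
    rw [ENNReal.tsum_prod', ← ENNReal.tsum_mul_left]
    refine tsum_congr fun z => ?_
    rw [tsum_fintype]
    simp [g, ZMod.card]
  have hweight : ∀ e ∈ s, 1 ≤ ENNReal.ofReal (D ^ p) ^ n * ((c e).map g).prod := by
    intro e he
    have h1 : (c e).map g = (f e).map (polyWeight p) := by
      rw [← hmap, List.map_map]; rfl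
    have h2 : ((stepProd (f e) : ℕ) : ℝ) ≤ D ^ n := by
      have := (hf e he).2.2
      rw [hn e he] at this
      rw [hD]
      exact_mod_cast this
    have h3 : (0 : ℝ) < stepProd (f e) := by
      have : 0 < stepProd (f e) := by
        refine Nat.pos_of_ne_zero fun h0 => ?_
        obtain ⟨v, -, hv⟩ := List.mem_map.1 (List.prod_eq_zero_iff.1 h0)
        omega
      exact_mod_cast this
    rw [h1, prod_polyWeight, ← ENNReal.ofReal_pow (by positivity),
      ← ENNReal.ofReal_mul (by positivity), ← ENNReal.ofReal_one]
    apply ENNReal.ofReal_le_ofReal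
    rw [Real.rpow_neg h3.le, ← Real.rpow_natCast, ← Real.rpow_mul hDpos.le, mul_comm p,
      Real.rpow_mul hDpos.le, Real.rpow_natCast, ← div_eq_mul_inv,
      one_le_div (Real.rpow_pos_of_pos h3 _)]
    exact Real.rpow_le_rpow h3.le h2 hp
  rcases s.eq_empty_or_nonempty with rfl | ⟨e₀, he₀⟩
  · simp
  have hlen : ∀ l ∈ s.image c, l.length = 2 * n - 1 := by
    intro l hl
    obtain ⟨e, he, rfl⟩ := Finset.mem_image.1 hl
    have h1 := (hf e he).1
    rw [hn e he, ← hmap, List.length_map] at h1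
    omega
  calc (s.card : ENNReal) = ∑ e ∈ s, 1 := by simp
    _ ≤ ∑ e ∈ s, ENNReal.ofReal (D ^ p) ^ n * ((c e).map g).prod := Finset.sum_le_sum hweight
    _ = ENNReal.ofReal (D ^ p) ^ n * ∑ l ∈ s.image c, (l.map g).prod := by
        rw [← Finset.mul_sum, Finset.sum_image hinj]
    _ ≤ ENNReal.ofReal (D ^ p) ^ n * (q * ∑' z : Zd d, polyWeight p z) ^ (2 * n - 1) := by
        gcongr
        rw [← hg]
        exact sum_list_prod_le_tsum_pow g _ _ hlen
    _ ≤ ENNReal.ofReal (D ^ p) ^ n * (1 + q * ∑' z : Zd d, polyWeight p z) ^ (2 * n) := by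
        refine mul_le_mul_right ?_ _
        refine (pow_le_pow_left' le_add_self _).trans (pow_le_pow_right' le_self_add (by omega))
    _ = growthRate d q M a p ^ n := by rw [growthRate, mul_pow, ← pow_mul]

/-- The generating function of clusters with potentials not vanishing at a given point. -/
lemma sum_pow_card_le [NeZero q] (hM : 1 ≤ M) {p : ℝ} (hp : 0 ≤ p) {i₀ : Fin d} {x : Zd d}
    {s : Finset (Finset (Zd d) × (Zd d → ZMod q))} (hc : ∀ e ∈ s, IsCluster M a e.1)
    (hpot : ∀ e ∈ s, IsPotential i₀ e.2 e.1) (hx : ∀ e ∈ s, e.2 x ≠ 0) (z : ENNReal) :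
    ∑ e ∈ s, z ^ e.1.card ≤
      z * growthRate d q M a p * (1 - z * growthRate d q M a p)⁻¹ := by
  classical
  set B := growthRate d q M a p with hB
  let t : Finset ℕ := s.image fun e => e.1.card - 1
  have hmaps : ∀ e ∈ s, e.1.card - 1 ∈ t := fun e he => Finset.mem_image_of_mem _ he
  rw [← Finset.sum_fiberwise_of_maps_to hmaps, ← ENNReal.tsum_geometric, ← ENNReal.tsum_mul_left]
  refine le_trans (Finset.sum_le_sum fun n _ => ?_) (ENNReal.sum_le_tsum t)
  have hcard : ∀ e ∈ s.filter (fun e => e.1.card - 1 = n), e.1.card = n + 1 := by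
    intro e he
    rw [Finset.mem_filter] at he
    have := Finset.card_pos.2 (hc e he.1).nonempty
    omega
  have h1 := card_le_growthRate_pow (s := s.filter fun e => e.1.card - 1 = n) hM hp
    (fun e he => hc e (Finset.mem_filter.1 he).1) (fun e he => hpot e (Finset.mem_filter.1 he).1)
    (fun e he => hx e (Finset.mem_filter.1 he).1) hcard
  rw [Finset.sum_congr rfl fun e he => by rw [hcard e he], Finset.sum_const, nsmul_eq_mul,
    ← pow_succ', mul_pow, mul_comm]
  gcongr

end Counting

open Classical in
/-- The indicator of a proposition. -/
def ind (P : Prop) : ENNReal := if P then 1 else 0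

lemma ind_of {P : Prop} (h : P) : ind P = 1 := by simp [ind, h]

lemma ind_of_not {P : Prop} (h : ¬P) : ind P = 0 := by simp [ind, h]

lemma ind_mono {P Q : Prop} (h : P → Q) : ind P ≤ ind Q := by
  by_cases hP : P
  · rw [ind_of hP, ind_of (h hP)]
  · rw [ind_of_not hP]; exact bot_le

lemma ind_le_one (P : Prop) : ind P ≤ 1 := by
  by_cases hP : P
  · rw [ind_of hP]
  · rw [ind_of_not hP]; exact bot_le

lemma ind_or_le (P Q : Prop) : ind (P ∨ Q) ≤ ind P + ind Q := by
  by_cases hP : P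
  · rw [ind_of hP]; exact (ind_le_one _).trans le_self_add
  · by_cases hQ : Q
    · rw [ind_of hQ]; exact (ind_le_one _).trans le_add_self
    · rw [ind_of_not (by tauto)]; exact bot_le

lemma ind_exists_le_sum {β : Type*} (s : Finset β) (P : β → Prop) :
    ind (∃ e ∈ s, P e) ≤ ∑ e ∈ s, ind (P e) := by
  by_cases h : ∃ e ∈ s, P e
  · obtain ⟨e, he, hP⟩ := h
    calc _ ≤ 1 := ind_le_one _
      _ = ind (P e) := (ind_of hP).symm
      _ ≤ _ := Finset.single_le_sum (f := fun e => ind (P e)) (fun _ _ => bot_le) he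
  · rw [ind_of_not h]; exact bot_le

lemma mul_ind_le {P : Prop} {a b : ENNReal} (h : P → a ≤ b) : a * ind P ≤ b := by
  by_cases hP : P
  · rw [ind_of hP, mul_one]; exact h hP
  · rw [ind_of_not hP, mul_zero]; exact bot_le

section Energy
variable {d q : ℕ} {M a : ℕ}

/-- Some potential in `Γ` separates `x` and `y`. -/
def Disc (Γ : Finset (Finset (Zd d) × (Zd d → ZMod q))) (x y : Zd d) : Prop :=
  ∃ e ∈ Γ, e.2 x ≠ e.2 y

/-- Some potential in `Γ` and another one in `E` separate `x` and `y`. -/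
def Clash (Γ E : Finset (Finset (Zd d) × (Zd d → ZMod q))) (x y : Zd d) : Prop :=
  ∃ e ∈ Γ, ∃ e' ∈ E, e' ≠ e ∧ e.2 x ≠ e.2 y ∧ e'.2 x ≠ e'.2 y

/-- The total coupling of the ordered pairs satisfying `P`. -/
def pairWeight (J α : ℝ) (P : Zd d → Zd d → Prop) : ENNReal :=
  ∑' x, ∑' y, coupling J α (x - y) * ind (P x y)

lemma pairWeight_mono {J α : ℝ} {P Q : Zd d → Zd d → Prop} (h : ∀ x y, P x y → Q x y) :
    pairWeight J α P ≤ pairWeight J α Q :=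
  ENNReal.tsum_le_tsum fun x => ENNReal.tsum_le_tsum fun y =>
    mul_le_mul_right (ind_mono (h x y)) _

lemma pairWeight_or_le {J α : ℝ} (P Q : Zd d → Zd d → Prop) :
    pairWeight J α (fun x y => P x y ∨ Q x y) ≤ pairWeight J α P + pairWeight J α Q := by
  simp only [pairWeight, ← ENNReal.tsum_add, ← mul_add]
  exact ENNReal.tsum_le_tsum fun x => ENNReal.tsum_le_tsum fun y =>
    mul_le_mul_right (ind_or_le _ _) _

lemma pairWeight_swap {J α : ℝ} (P : Zd d → Zd d → Prop) :
    pairWeight J α (fun x y => P y x) = pairWeight J α P := by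
  rw [pairWeight, ENNReal.tsum_comm, pairWeight]
  refine tsum_congr fun x => tsum_congr fun y => ?_
  rw [← coupling_neg, neg_sub]

lemma pairWeight_exists_le {J α : ℝ} {β : Type*} (s : Finset β) (P : β → Zd d → Zd d → Prop) :
    pairWeight J α (fun x y => ∃ e ∈ s, P e x y) ≤ ∑ e ∈ s, pairWeight J α (P e) := by
  calc _ ≤ ∑' x, ∑' y, ∑ e ∈ s, coupling J α (x - y) * ind (P e x y) := by
        refine ENNReal.tsum_le_tsum fun x => ENNReal.tsum_le_tsum fun y => ?_
        rw [← Finset.mul_sum]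
        exact mul_le_mul_right (ind_exists_le_sum _ _) _
    _ = ∑ e ∈ s, pairWeight J α (P e) := by
        simp only [pairWeight]
        rw [← Summable.tsum_finsetSum fun _ _ => ENNReal.summable]
        exact tsum_congr fun x => Summable.tsum_finsetSum fun _ _ => ENNReal.summable

lemma pairWeight_mem_far_le {J α : ℝ} (A : Finset (Zd d)) (R : ℕ) :
    pairWeight J α (fun x y => x ∈ A ∧ R ≤ natNorm (x - y)) ≤ A.card * couplingTail d J α R := by
  calc _ ≤ ∑' x, (if x ∈ A then couplingTail d J α R else 0) := by
        refine ENNReal.tsum_le_tsum fun x => ?_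
        split_ifs with hx
        · rw [couplingTail, ← (Equiv.subLeft x).tsum_eq]
          refine ENNReal.tsum_le_tsum fun y => mul_ind_le fun h => ?_
          have h2 : R ≤ natNorm y := by simpa using h.2
          simp [h2]
        · simp [ind_of_not, hx]
    _ = _ := by
        rw [tsum_eq_sum (s := A) (by intro x hx; simp [hx]),
          Finset.sum_congr rfl fun x hx => if_pos hx, Finset.sum_const, nsmul_eq_mul]

/-- The interaction of a potential at distance at least `R`. -/
lemma pairWeight_potential_far_le {J α : ℝ} {i₀ : Fin d} {τ : Zd d → ZMod q} {γ : Finset (Zd d)}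
    (h : IsPotential i₀ τ γ) (R : ℕ) :
    pairWeight J α (fun x y => τ x ≠ τ y ∧ R ≤ natNorm (x - y)) ≤
      2 * ((γ.card : ENNReal) ^ 2 * couplingTail d J α R) := by
  obtain ⟨A, hA, hcard⟩ := h.exists_support
  have hA' : (A.card : ENNReal) ≤ (γ.card : ENNReal) ^ 2 := by exact_mod_cast hcard
  have h1 : pairWeight J α (fun x y => x ∈ A ∧ R ≤ natNorm (x - y)) ≤
      (γ.card : ENNReal) ^ 2 * couplingTail d J α R :=
    (pairWeight_mem_far_le A R).trans (mul_le_mul_left hA' _)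
  rw [two_mul]
  refine le_trans (le_trans (pairWeight_mono fun x y hxy => ?_) (pairWeight_or_le
    (fun x y => x ∈ A ∧ R ≤ natNorm (x - y)) (fun x y => y ∈ A ∧ R ≤ natNorm (y - x))))
    (add_le_add h1 ?_)
  · rw [hA, hA, natNorm_sub_comm y x]
    by_cases hx : τ x = 0
    · exact Or.inr ⟨fun hy => hxy.1 (hx.trans hy.symm), hxy.2⟩
    · exact Or.inl ⟨hx, hxy.2⟩
  · rw [pairWeight_swap (fun x y => x ∈ A ∧ R ≤ natNorm (x - y))]
    exact h1

section
variable {i₀ : Fin d} {s : Zd d → ZMod q} {r : ZMod q}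
  {E Γ : Finset (Finset (Zd d) × (Zd d → ZMod q))}

lemma Decomp.card_pos (h : Decomp i₀ M a s r E) {e : Finset (Zd d) × (Zd d → ZMod q)}
    (he : e ∈ E) : 0 < e.1.card := Finset.card_pos.2 (h.cluster e he).nonempty

lemma Decomp.far_of_clash (h : Decomp i₀ M a s r E) {e e' : Finset (Zd d) × (Zd d → ZMod q)}
    (he : e ∈ E) (he' : e' ∈ E) (hne : e ≠ e') {x y : Zd d} (hx : e.2 x ≠ e.2 y)
    (hx' : e'.2 x ≠ e'.2 y) : M * (min e.1.card e'.1.card) ^ a < 2 * natNorm (x - y) := by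
  obtain ⟨p, hp, hpx⟩ := (h.pot e he).gradient.exists_mem_near hx
  obtain ⟨p', hp', hpx'⟩ := (h.pot e' he').gradient.exists_mem_near hx'
  have h1 := h.sep e he e' he' hne p hp p' hp'
  have h2 := natNorm_sub_le p x p'
  rw [natNorm_sub_comm p x] at h2
  omega

lemma Decomp.pairwiseDisjoint (h : Decomp i₀ M a s r E) :
    (E : Set (Finset (Zd d) × (Zd d → ZMod q))).PairwiseDisjoint Prod.fst := by
  intro e he e' he' hne
  refine Finset.disjoint_left.2 fun p hp hp' => ?_
  have := h.sep e he e' he' hne p hp p hp'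
  rw [sub_self, natNorm_zero] at this
  omega

lemma Decomp.card_le_pairWeight (h : Decomp i₀ M a s r E) (hΓ : Γ ⊆ E) (J α : ℝ) :
    ENNReal.ofReal J * ((∑ e ∈ Γ, e.1.card : ℕ) : ENNReal) ≤ pairWeight J α (Disc Γ) := by
  have hcard : (Γ.biUnion Prod.fst).card = ∑ e ∈ Γ, e.1.card :=
    Finset.card_biUnion fun e he e' he' hne => h.pairwiseDisjoint (hΓ he) (hΓ he') hne
  rw [← hcard, mul_comm, ← nsmul_eq_mul, ← Finset.sum_const]
  refine le_trans (Finset.sum_le_sum fun p hp => ?_)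
    (ENNReal.sum_le_tsum (Γ.biUnion Prod.fst))
  obtain ⟨e, he, hpe⟩ := Finset.mem_biUnion.1 hp
  obtain ⟨y, hy, hne⟩ := h.edge e (hΓ he) p hpe
  refine le_trans (le_of_eq ?_) (ENNReal.le_tsum y)
  have hD : Disc Γ p y := ⟨e, he, hne⟩
  have h0 : p - y ≠ 0 := fun h0 => by rw [h0, natNorm_zero] at hy; omega
  rw [ind_of hD, coupling, if_neg h0, hy]
  simp

lemma Decomp.pairWeight_disc_ne_top (h : Decomp i₀ M a s r E) (hΓ : Γ ⊆ E) {J α : ℝ} (hd : 0 < d)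
    (hJ : 0 ≤ J) (hα : (d : ℝ) < α) : pairWeight J α (Disc Γ) ≠ ⊤ := by
  refine ne_top_of_le_ne_top ?_ (pairWeight_exists_le Γ fun e x y => e.2 x ≠ e.2 y)
  refine ENNReal.sum_ne_top.2 fun e he => ?_
  refine ne_top_of_le_ne_top ?_ ((pairWeight_mono fun x y hxy => ⟨hxy, Nat.zero_le _⟩).trans
    (pairWeight_potential_far_le (h.pot e (hΓ he)) 0))
  have : couplingTail d J α 0 ≠ ⊤ := by
    simpa [couplingTail] using tsum_coupling_ne_top (d := d) hd hJ hα
  exact ENNReal.mul_ne_top (by simp) (ENNReal.mul_ne_top (by simp) this)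

/-- The points close to the cluster of `e`. -/
def Near (m a : ℕ) (e : Finset (Zd d) × (Zd d → ZMod q)) (x : Zd d) : Prop :=
  ∃ p ∈ e.1, natNorm (x - p) ≤ e.1.card ^ 2 + m * e.1.card ^ a

lemma sq_le_mul_pow {m a n : ℕ} (hm : 1 ≤ m) (ha : 4 ≤ a) (hn : 0 < n) : n ^ 2 ≤ m * n ^ a :=
  calc n ^ 2 ≤ n ^ a := Nat.pow_le_pow_right hn (by omega)
    _ ≤ m * n ^ a := Nat.le_mul_of_pos_left _ hm

/-- The constant `∑ 1 / n²`. -/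
def basel : ENNReal := ∑' n : ℕ, (((n + 1 : ℕ) : ENNReal) ^ 2)⁻¹

lemma Decomp.sum_near_le {m : ℕ} (h : Decomp i₀ (8 * m) a s r E) (hm : 1 ≤ m) (ha : 4 ≤ a)
    (x : Zd d) : ∑ e ∈ E, ((e.1.card : ENNReal) ^ 2)⁻¹ * ind (Near m a e x) ≤ basel := by
  classical
  have h1 : ∑ e ∈ E, ((e.1.card : ENNReal) ^ 2)⁻¹ * ind (Near m a e x) =
      ∑ e ∈ E.filter (fun e => Near m a e x), ((((e.1.card - 1) + 1 : ℕ) : ENNReal) ^ 2)⁻¹ := by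
    rw [Finset.sum_filter]
    refine Finset.sum_congr rfl fun e he => ?_
    have := h.card_pos he
    rw [Nat.sub_add_cancel this]
    split_ifs with hN
    · rw [ind_of hN, mul_one]
    · rw [ind_of_not hN, mul_zero]
  rw [h1, ← Finset.sum_image (s := E.filter (fun e => Near m a e x)) (g := fun e => e.1.card - 1)
    (f := fun n : ℕ => (((n + 1 : ℕ) : ENNReal) ^ 2)⁻¹)]
  · exact ENNReal.sum_le_tsum _
  · intro e he e' he' hee
    rw [Finset.mem_coe, Finset.mem_filter] at he he'
    obtain ⟨he, p, hp, hpx⟩ := he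
    obtain ⟨he', p', hp', hpx'⟩ := he'
    by_contra hne
    have c1 := h.card_pos he
    have c2 := h.card_pos he'
    have hc : e'.1.card = e.1.card := by simp only at hee; omega
    have h2 := h.sep e he e' he' hne p hp p' hp'
    rw [hc] at h2 hpx'
    rw [min_self] at h2
    have h3 := natNorm_sub_le p x p'
    rw [natNorm_sub_comm p x] at h3
    have h4 := sq_le_mul_pow (a := a) hm ha c1
    rw [mul_assoc] at h2
    omega

/-- Moving `x` by fewer than `m n ^ a` steps does not affect the larger clusters. -/
lemma Decomp.small_translate {m : ℕ} (h : Decomp i₀ (8 * m) a s r E) (hm : 1 ≤ m) (ha : 4 ≤ a)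
    {J α : ℝ} (hJ : 0 ≤ J) (hα : 0 ≤ α)
    (hΓ : Γ ⊆ E) {e' : Finset (Zd d) × (Zd d → ZMod q)} (he' : e' ∈ E) {x : Zd d}
    (hx : e'.2 x ≠ 0) {t : ℕ} (ht : t < m * e'.1.card ^ a) :
    ∑' y, coupling J α (x - y) * ind (∃ e ∈ Γ, e ≠ e' ∧ e'.1.card ≤ e.1.card ∧
        e.2 x ≠ e.2 y ∧ e'.2 x ≠ e'.2 y) ≤
      ENNReal.ofReal (2 ^ α) * ∑' y, coupling J α (x + (Pi.single i₀ (t : ℤ) : Zd d) - y) *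
        ind (Disc Γ (x + (Pi.single i₀ (t : ℤ) : Zd d)) y) := by
  rw [← ENNReal.tsum_mul_left]
  refine ENNReal.tsum_le_tsum fun y => mul_ind_le ?_
  rintro ⟨e, heΓ, hne, hle, hxy, hxy'⟩
  have c1 := h.card_pos he'
  have hfar := h.far_of_clash (hΓ heΓ) he' hne hxy hxy'
  have h4 := sq_le_mul_pow (a := a) hm ha c1
  rw [min_eq_right hle, mul_assoc] at hfar
  set x' : Zd d := x + (Pi.single i₀ (t : ℤ) : Zd d) with hx'
  have hxx' : natNorm (x - x') = t := by
    rw [natNorm_sub_comm, hx', add_sub_cancel_left, natNorm_single]; simp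
  have heq : e.2 x = e.2 x' := by
    by_contra hc
    obtain ⟨p, hp, hpx⟩ := (h.pot e (hΓ heΓ)).gradient.exists_mem_near hc
    obtain ⟨p', hp', hpx'⟩ := (h.pot e' he').exists_mem_near hx
    have h2 := h.sep e (hΓ heΓ) e' he' hne p hp p' hp'
    rw [min_eq_right hle, mul_assoc] at h2
    have h3 := natNorm_sub_le p x p'
    rw [natNorm_sub_comm p x] at h3
    omega
  have hD : Disc Γ x' y := ⟨e, heΓ, heq ▸ hxy⟩
  rw [ind_of hD, mul_one]
  refine coupling_le_two_rpow_mul hJ hα (fun h0 => hxy ?_) ?_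
  · rw [heq, sub_eq_zero.1 h0]
  · have h3 := natNorm_sub_le x' x y
    rw [natNorm_sub_comm x' x] at h3
    omega

lemma Decomp.small_one_le {m : ℕ} (h : Decomp i₀ (8 * m) a s r E) (hm : 1 ≤ m) (ha : 4 ≤ a)
    {J α : ℝ} (hJ : 0 ≤ J) (hα : 0 ≤ α)
    (hΓ : Γ ⊆ E) {e' : Finset (Zd d) × (Zd d → ZMod q)} (he' : e' ∈ E) :
    pairWeight J α (fun x y => e'.2 x ≠ 0 ∧ ∃ e ∈ Γ, e ≠ e' ∧ e'.1.card ≤ e.1.card ∧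
        e.2 x ≠ e.2 y ∧ e'.2 x ≠ e'.2 y) ≤
      ENNReal.ofReal (2 ^ α) / m * ∑' x, (∑' y, coupling J α (x - y) * ind (Disc Γ x y)) *
        (((e'.1.card : ENNReal) ^ 2)⁻¹ * ind (Near m a e' x)) := by
  obtain ⟨A, hA, hAcard⟩ := (h.pot e' he').exists_support
  set n := e'.1.card with hn
  have hn0 : 0 < n := h.card_pos he'
  set f : Zd d → ENNReal := fun x => ∑' y, coupling J α (x - y) * ind (Disc Γ x y) with hf
  set S : ENNReal := ∑' x, f x * ind (Near m a e' x) with hS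
  set T := m * n ^ a with hT
  have hT0 : 0 < T := by positivity
  set g : Zd d → ENNReal := fun x => ∑' y, coupling J α (x - y) * ind (∃ e ∈ Γ, e ≠ e' ∧
    e'.1.card ≤ e.1.card ∧ e.2 x ≠ e.2 y ∧ e'.2 x ≠ e'.2 y) with hg
  have h1 : pairWeight J α (fun x y => e'.2 x ≠ 0 ∧ ∃ e ∈ Γ, e ≠ e' ∧ e'.1.card ≤ e.1.card ∧
        e.2 x ≠ e.2 y ∧ e'.2 x ≠ e'.2 y) ≤ ∑ x ∈ A, g x := by
    rw [pairWeight, tsum_eq_sum (s := A)]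
    · exact Finset.sum_le_sum fun x _ => ENNReal.tsum_le_tsum fun y =>
        mul_le_mul_right (ind_mono fun hh => hh.2) _
    · intro x hx
      refine ENNReal.tsum_eq_zero.2 fun y => ?_
      rw [ind_of_not fun hh => hx ((hA x).2 hh.1), mul_zero]
  have h2 : ∀ x ∈ A, (T : ENNReal) * g x ≤ ENNReal.ofReal (2 ^ α) * S := by
    intro x hx
    have hx0 := (hA x).1 hx
    let c : ℕ → Zd d := fun t => x + (Pi.single i₀ (t : ℤ) : Zd d)
    have hc : Set.InjOn c (Finset.range T : Finset ℕ) := by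
      intro t _ t' _ htt
      have := congrFun htt i₀
      simpa [c] using this
    calc (T : ENNReal) * g x = ∑ t ∈ Finset.range T, g x := by simp
      _ ≤ ∑ t ∈ Finset.range T, ENNReal.ofReal (2 ^ α) * f (c t) :=
          Finset.sum_le_sum fun t ht =>
            h.small_translate hm ha hJ hα hΓ he' hx0 (Finset.mem_range.1 ht)
      _ = ENNReal.ofReal (2 ^ α) * ∑ t ∈ Finset.range T, f (c t) * ind (Near m a e' (c t)) := by
          rw [Finset.mul_sum]
          refine Finset.sum_congr rfl fun t ht => ?_
          rw [ind_of, mul_one]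
          obtain ⟨p, hp, hpx⟩ := (h.pot e' he').exists_mem_near hx0
          refine ⟨p, hp, ?_⟩
          have h3 := natNorm_sub_le (c t) x p
          have h4 : natNorm (c t - x) = t := by
            simp only [c]; rw [add_sub_cancel_left, natNorm_single]; simp
          rw [Finset.mem_range] at ht
          rw [← hn] at hpx ⊢
          omega
      _ = ENNReal.ofReal (2 ^ α) * ∑ x' ∈ (Finset.range T).image c,
            f x' * ind (Near m a e' x') := by rw [Finset.sum_image hc]
      _ ≤ _ := mul_le_mul_right (ENNReal.sum_le_tsum _) _
  have hm0 : (m : ENNReal) ≠ 0 := by exact_mod_cast (by omega : m ≠ 0)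
  have hn0' : ((n : ENNReal) ^ 2) ≠ 0 := by simp; omega
  have hrhs : ENNReal.ofReal (2 ^ α) / m * ∑' x, f x * (((n : ENNReal) ^ 2)⁻¹ *
      ind (Near m a e' x)) = ENNReal.ofReal (2 ^ α) * S / (m * (n : ENNReal) ^ 2) := by
    have : ∀ x, f x * (((n : ENNReal) ^ 2)⁻¹ * ind (Near m a e' x)) =
        ((n : ENNReal) ^ 2)⁻¹ * (f x * ind (Near m a e' x)) := fun x => by ring
    simp only [this]
    rw [ENNReal.tsum_mul_left, ← hS, div_eq_mul_inv, div_eq_mul_inv,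
      ENNReal.mul_inv (Or.inl hm0) (Or.inl (by simp))]
    ring
  rw [hrhs]
  refine h1.trans ((ENNReal.le_div_iff_mul_le (Or.inl (mul_ne_zero hm0 hn0'))
    (Or.inl (by finiteness))).2 ?_)
  have hn2 : ((n : ENNReal) ^ 2) ≠ ⊤ := by finiteness
  refine (ENNReal.mul_le_mul_iff_left hn0' hn2).1 ?_
  have hle : (m * (n : ENNReal) ^ 2) * (n : ENNReal) ^ 2 ≤ T := by
    have : (m * n ^ 2) * n ^ 2 ≤ T := by
      rw [hT, mul_assoc, ← pow_add]
      exact Nat.mul_le_mul_left _ (Nat.pow_le_pow_right hn0 ha)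
    exact_mod_cast this
  calc (∑ x ∈ A, g x) * (m * (n : ENNReal) ^ 2) * (n : ENNReal) ^ 2
      = (m * (n : ENNReal) ^ 2) * (n : ENNReal) ^ 2 * ∑ x ∈ A, g x := by ring
    _ ≤ T * ∑ x ∈ A, g x := mul_le_mul_left hle _
    _ = ∑ x ∈ A, T * g x := Finset.mul_sum _ _ _
    _ ≤ ∑ x ∈ A, ENNReal.ofReal (2 ^ α) * S := Finset.sum_le_sum h2
    _ = A.card * (ENNReal.ofReal (2 ^ α) * S) := by rw [Finset.sum_const, nsmul_eq_mul]
    _ ≤ (n : ENNReal) ^ 2 * (ENNReal.ofReal (2 ^ α) * S) := by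
        refine mul_le_mul_left ?_ _
        exact_mod_cast hAcard
    _ = _ := by ring

lemma Decomp.small_le {m : ℕ} (h : Decomp i₀ (8 * m) a s r E) (hm : 1 ≤ m) (ha : 4 ≤ a)
    {J α : ℝ} (hJ : 0 ≤ J) (hα : 0 ≤ α) (hΓ : Γ ⊆ E) :
    pairWeight J α (fun x y => ∃ e' ∈ E, e'.2 x ≠ 0 ∧ ∃ e ∈ Γ, e ≠ e' ∧ e'.1.card ≤ e.1.card ∧
        e.2 x ≠ e.2 y ∧ e'.2 x ≠ e'.2 y) ≤
      ENNReal.ofReal (2 ^ α) / m * basel * pairWeight J α (Disc Γ) := by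
  refine (pairWeight_exists_le E _).trans ?_
  refine (Finset.sum_le_sum fun e' he' => h.small_one_le hm ha hJ hα hΓ he').trans ?_
  rw [← Finset.mul_sum, mul_assoc, ← Summable.tsum_finsetSum fun _ _ => ENNReal.summable]
  refine mul_le_mul_right ?_ _
  rw [pairWeight, ← ENNReal.tsum_mul_left]
  refine ENNReal.tsum_le_tsum fun x => ?_
  rw [← Finset.mul_sum, mul_comm]
  exact mul_le_mul_left (h.sum_near_le hm ha x) _

/-- The interaction between different clusters is small compared to the energy of `Γ`. -/
lemma Decomp.clash_le {m : ℕ} (h : Decomp i₀ (8 * m) a s r E) (hm : 1 ≤ m) (ha : 4 ≤ a)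
    {J α : ℝ} (hJ : 0 < J) (hα : 0 ≤ α) (hΓ : Γ ⊆ E) {ε : ENNReal}
    (hε : ∀ n : ℕ, 1 ≤ n → (n : ENNReal) ^ 2 * couplingTail d J α (4 * (m * n ^ a)) ≤ ε) :
    pairWeight J α (Clash Γ E) ≤ (2 * ε / ENNReal.ofReal J +
      2 * (ENNReal.ofReal (2 ^ α) / m * basel)) * pairWeight J α (Disc Γ) := by
  let Large : Zd d → Zd d → Prop := fun x y => ∃ e ∈ Γ, e.2 x ≠ e.2 y ∧
    4 * (m * e.1.card ^ a) ≤ natNorm (x - y)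
  let Small : Zd d → Zd d → Prop := fun x y => ∃ e' ∈ E, e'.2 x ≠ 0 ∧ ∃ e ∈ Γ, e ≠ e' ∧
    e'.1.card ≤ e.1.card ∧ e.2 x ≠ e.2 y ∧ e'.2 x ≠ e'.2 y
  have hsmall : pairWeight J α Small ≤ _ := h.small_le hm ha hJ.le hα hΓ
  have hlarge : pairWeight J α Large ≤ 2 * ε / ENNReal.ofReal J * pairWeight J α (Disc Γ) := by
    have h1 : pairWeight J α Large ≤ 2 * ε * ((∑ e ∈ Γ, e.1.card : ℕ) : ENNReal) := by
      refine (pairWeight_exists_le Γ _).trans ?_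
      push_cast
      rw [Finset.mul_sum]
      refine Finset.sum_le_sum fun e he => ?_
      have c1 := h.card_pos (hΓ he)
      refine (pairWeight_potential_far_le (h.pot e (hΓ he)) _).trans ?_
      calc _ ≤ 2 * ε * 1 := by rw [mul_one]; exact mul_le_mul_right (hε _ c1) _
        _ ≤ _ := mul_le_mul_right (by exact_mod_cast c1) _
    have hJ0 : ENNReal.ofReal J ≠ 0 := by simpa using hJ
    calc _ ≤ 2 * ε * ((∑ e ∈ Γ, e.1.card : ℕ) : ENNReal) := h1
      _ ≤ 2 * ε * (pairWeight J α (Disc Γ) / ENNReal.ofReal J) := by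
          refine mul_le_mul_right ?_ _
          rw [ENNReal.le_div_iff_mul_le (Or.inl hJ0) (Or.inl (by simp)), mul_comm]
          exact h.card_le_pairWeight hΓ J α
      _ = _ := by rw [div_eq_mul_inv, div_eq_mul_inv]; ring
  have hcover : ∀ x y, Clash Γ E x y → Large x y ∨ (Small x y ∨ Small y x) := by
    rintro x y ⟨e, he, e', he', hne, hxy, hxy'⟩
    have hfar := h.far_of_clash (hΓ he) he' hne.symm hxy hxy'
    rcases le_total e.1.card e'.1.card with hle | hle
    · refine Or.inl ⟨e, he, hxy, ?_⟩
      rw [min_eq_left hle, mul_assoc] at hfar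
      omega
    · refine Or.inr ?_
      by_cases hx : e'.2 x = 0
      · exact Or.inr ⟨e', he', fun hy => hxy' (hx.trans hy.symm), e, he, hne.symm, hle, hxy.symm,
          hxy'.symm⟩
      · exact Or.inl ⟨e', he', hx, e, he, hne.symm, hle, hxy, hxy'⟩
  calc _ ≤ pairWeight J α (fun x y => Large x y ∨ (Small x y ∨ Small y x)) :=
        pairWeight_mono hcover
    _ ≤ pairWeight J α Large + (pairWeight J α Small + pairWeight J α (fun x y => Small y x)) :=
        (pairWeight_or_le _ _).trans (add_le_add_right (pairWeight_or_le _ _) _)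
    _ ≤ _ := by
        rw [pairWeight_swap Small, add_mul]
        refine add_le_add hlarge ?_
        rw [mul_assoc, two_mul]
        exact add_le_add hsmall hsmall

end

end Energy

/-- The sum of `J_{xy} c x y` over unordered pairs meeting `Λ`. -/
def pairSum {d : ℕ} (J α : ℝ) (Λ : Finset (Zd d)) (c : Zd d → Zd d → ℝ) : ℝ :=
  1 / 2 * (∑ x ∈ Λ, ∑ y ∈ Λ, Jcoup d J α x y * c x y) +
    ∑ x ∈ Λ, ∑' y : Zd d, if y ∈ Λ then 0 else Jcoup d J α x y * c x y

section PairSum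
variable {d q : ℕ} {J α : ℝ}

lemma ham_eq_neg_pairSum {φ : ZMod q → ℝ} {Λ : Finset (Zd d)} {r : ZMod q} {σ : Zd d → ZMod q}
    (hr : ∀ x, x ∉ Λ → σ x = r) :
    ham d q J α φ Λ r σ = -pairSum J α Λ (fun x y => φ (σ x - σ y)) := by
  have : ∀ x, (∑' y : Zd d, if y ∈ Λ then 0 else Jcoup d J α x y * φ (σ x - r)) =
      ∑' y : Zd d, if y ∈ Λ then 0 else Jcoup d J α x y * φ (σ x - σ y) := by
    intro x
    refine tsum_congr fun y => ?_
    split_ifs with hy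
    · rfl
    · rw [hr y hy]
  rw [ham, pairSum]
  simp only [this]
  ring

lemma summable_Jcoup (hd : 0 < d) (hJ : 0 ≤ J) (hα : (d : ℝ) < α) (x : Zd d) :
    Summable fun y => Jcoup d J α x y := by
  have h1 : ∑' y, ENNReal.ofReal (Jcoup d J α x y) ≠ ⊤ := by
    simp only [ofReal_Jcoup]
    have := (Equiv.subLeft x).tsum_eq (coupling J α)
    simp only [Equiv.subLeft_apply] at this
    rw [this]
    exact tsum_coupling_ne_top hd hJ hα
  refine (ENNReal.summable_toReal h1).congr fun y => ?_
  rw [ENNReal.toReal_ofReal (Jcoup_nonneg hJ α x y)]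

lemma summable_pairSum (hd : 0 < d) (hJ : 0 ≤ J) (hα : (d : ℝ) < α) (Λ : Finset (Zd d))
    {c : Zd d → Zd d → ℝ} {B : ℝ} (hc : ∀ x y, |c x y| ≤ B) (x : Zd d) :
    Summable fun y => if y ∈ Λ then 0 else Jcoup d J α x y * c x y := by
  refine Summable.of_norm_bounded ((summable_Jcoup hd hJ hα x).mul_right B) fun y => ?_
  have h0 := Jcoup_nonneg hJ α x y
  have hB : 0 ≤ B := (abs_nonneg _).trans (hc x y)
  split_ifs
  · simpa using mul_nonneg h0 hB
  · rw [Real.norm_eq_abs, abs_mul, abs_of_nonneg h0]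
    exact mul_le_mul_of_nonneg_left (hc x y) h0

lemma pairSum_mono (hd : 0 < d) (hJ : 0 ≤ J) (hα : (d : ℝ) < α) (Λ : Finset (Zd d))
    {c c' : Zd d → Zd d → ℝ} {B B' : ℝ} (hc : ∀ x y, |c x y| ≤ B) (hc' : ∀ x y, |c' x y| ≤ B')
    (h : ∀ x y, c x y ≤ c' x y) : pairSum J α Λ c ≤ pairSum J α Λ c' := by
  have key : ∀ x y, Jcoup d J α x y * c x y ≤ Jcoup d J α x y * c' x y := fun x y =>
    mul_le_mul_of_nonneg_left (h x y) (Jcoup_nonneg hJ α x y)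
  refine add_le_add (mul_le_mul_of_nonneg_left (Finset.sum_le_sum fun x _ =>
    Finset.sum_le_sum fun y _ => key x y) (by norm_num)) (Finset.sum_le_sum fun x _ => ?_)
  refine (summable_pairSum hd hJ hα Λ hc x).tsum_le_tsum (fun y => ?_)
    (summable_pairSum hd hJ hα Λ hc' x)
  split_ifs
  · rfl
  · exact key x y

lemma pairSum_add_mul (hd : 0 < d) (hJ : 0 ≤ J) (hα : (d : ℝ) < α) (Λ : Finset (Zd d))
    {c c' : Zd d → Zd d → ℝ} {B B' : ℝ} (hc : ∀ x y, |c x y| ≤ B) (hc' : ∀ x y, |c' x y| ≤ B')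
    (k : ℝ) : pairSum J α Λ (fun x y => c x y + k * c' x y) =
      pairSum J α Λ c + k * pairSum J α Λ c' := by
  have h1 : ∀ x, (∑' y : Zd d, if y ∈ Λ then 0 else Jcoup d J α x y * (c x y + k * c' x y)) =
      (∑' y : Zd d, if y ∈ Λ then 0 else Jcoup d J α x y * c x y) +
      k * ∑' y : Zd d, if y ∈ Λ then 0 else Jcoup d J α x y * c' x y := by
    intro x
    rw [← tsum_mul_left, ← (summable_pairSum hd hJ hα Λ hc x).tsum_add
      ((summable_pairSum hd hJ hα Λ hc' x).mul_left k)]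
    refine tsum_congr fun y => ?_
    split_ifs
    · simp
    · ring
  have h2 : ∀ x, (∑ y ∈ Λ, Jcoup d J α x y * (c x y + k * c' x y)) =
      (∑ y ∈ Λ, Jcoup d J α x y * c x y) + k * ∑ y ∈ Λ, Jcoup d J α x y * c' x y := by
    intro x
    rw [Finset.mul_sum, ← Finset.sum_add_distrib]
    exact Finset.sum_congr rfl fun y _ => by ring
  simp only [pairSum, h1, h2, Finset.sum_add_distrib, ← Finset.mul_sum]
  ring

lemma abs_toReal_ind_le (P : Prop) : |(ind P).toReal| ≤ 1 := by
  rw [abs_of_nonneg ENNReal.toReal_nonneg]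
  exact ENNReal.toReal_mono ENNReal.one_ne_top (ind_le_one P)

lemma ofReal_Jcoup_mul_ind (hJ : 0 ≤ J) (x y : Zd d) (P : Prop) :
    ENNReal.ofReal (Jcoup d J α x y * (ind P).toReal) = coupling J α (x - y) * ind P := by
  rw [ENNReal.ofReal_mul (Jcoup_nonneg hJ α x y), ofReal_Jcoup,
    ENNReal.ofReal_toReal (ne_top_of_le_ne_top ENNReal.one_ne_top (ind_le_one P))]

lemma ofReal_pairSum_ind (hd : 0 < d) (hJ : 0 ≤ J) (hα : (d : ℝ) < α) (Λ : Finset (Zd d))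
    (P : Zd d → Zd d → Prop) :
    ENNReal.ofReal (pairSum J α Λ fun x y => (ind (P x y)).toReal) =
      2⁻¹ * pairWeight J α (fun x y => x ∈ Λ ∧ y ∈ Λ ∧ P x y) +
        pairWeight J α (fun x y => x ∈ Λ ∧ y ∉ Λ ∧ P x y) := by
  have hnn : ∀ x y, 0 ≤ Jcoup d J α x y * (ind (P x y)).toReal := fun x y =>
    mul_nonneg (Jcoup_nonneg hJ α x y) ENNReal.toReal_nonneg
  have hnn' : ∀ x y, 0 ≤ if y ∈ Λ then 0 else Jcoup d J α x y * (ind (P x y)).toReal := by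
    intro x y
    split_ifs
    · rfl
    · exact hnn x y
  have hrow : ∀ Q : Zd d → Zd d → Prop, pairWeight J α (fun x y => x ∈ Λ ∧ Q x y) =
      ∑ x ∈ Λ, ∑' y, coupling J α (x - y) * ind (Q x y) := by
    intro Q
    rw [pairWeight, tsum_eq_sum (s := Λ)]
    · exact Finset.sum_congr rfl fun x hx => by simp [hx]
    · intro x hx
      simp [hx, ind_of_not]
  rw [pairSum, ENNReal.ofReal_add, ENNReal.ofReal_mul (by norm_num),
    ENNReal.ofReal_sum_of_nonneg, ENNReal.ofReal_sum_of_nonneg, hrow, hrow]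
  · congr 1
    · congr 1
      · rw [one_div, ENNReal.ofReal_inv_of_pos (by norm_num)]; simp
      · refine Finset.sum_congr rfl fun x _ => ?_
        rw [ENNReal.ofReal_sum_of_nonneg fun y _ => hnn x y, tsum_eq_sum (s := Λ)]
        · refine Finset.sum_congr rfl fun y hy => ?_
          rw [ofReal_Jcoup_mul_ind hJ]
          simp [hy]
        · intro y hy
          simp [hy, ind_of_not]
    · refine Finset.sum_congr rfl fun x _ => ?_
      rw [ENNReal.ofReal_tsum_of_nonneg (hnn' x)
        (summable_pairSum hd hJ hα Λ (fun x y => abs_toReal_ind_le (P x y)) x)]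
      refine tsum_congr fun y => ?_
      split_ifs with hy
      · simp [hy, ind_of_not]
      · rw [ofReal_Jcoup_mul_ind hJ]
        simp [hy]
  · exact fun x _ => tsum_nonneg (hnn' x)
  · exact fun x _ => Finset.sum_nonneg fun y _ => hnn x y
  · exact mul_nonneg (by norm_num) (Finset.sum_nonneg fun x _ => Finset.sum_nonneg fun y _ => hnn x y)
  · exact Finset.sum_nonneg fun x _ => tsum_nonneg (hnn' x)

lemma pairWeight_add_le {P P₁ P₂ : Zd d → Zd d → Prop} (h₁ : ∀ x y, P₁ x y → P x y)
    (h₂ : ∀ x y, P₂ x y → P x y) (h : ∀ x y, P₁ x y → ¬P₂ x y) :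
    pairWeight J α P₁ + pairWeight J α P₂ ≤ pairWeight J α P := by
  simp only [pairWeight, ← ENNReal.tsum_add, ← mul_add]
  refine ENNReal.tsum_le_tsum fun x => ENNReal.tsum_le_tsum fun y => mul_le_mul_right ?_ _
  by_cases hP : P₁ x y
  · rw [ind_of_not (h x y hP), add_zero]; exact ind_mono (h₁ x y)
  · rw [ind_of_not hP, zero_add]; exact ind_mono (h₂ x y)

lemma ofReal_pairSum_ind_le (hd : 0 < d) (hJ : 0 ≤ J) (hα : (d : ℝ) < α) (Λ : Finset (Zd d))
    (P : Zd d → Zd d → Prop) :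
    ENNReal.ofReal (pairSum J α Λ fun x y => (ind (P x y)).toReal) ≤ pairWeight J α P := by
  rw [ofReal_pairSum_ind hd hJ hα]
  refine le_trans (add_le_add_left (mul_le_of_le_one_left' ?_) _) (pairWeight_add_le
    (fun x y h => h.2.2) (fun x y h => h.2.2) fun x y h h' => h'.2.1 h.2.1)
  exact ENNReal.inv_le_one.2 (by norm_num)

lemma pairWeight_le_pairSum (hd : 0 < d) (hJ : 0 ≤ J) (hα : (d : ℝ) < α) (Λ : Finset (Zd d))
    {P : Zd d → Zd d → Prop} (hP : ∀ x y, P x y → P y x) :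
    pairWeight J α P ≤ 2 * ENNReal.ofReal (pairSum J α Λ fun x y => (ind (P x y)).toReal) +
      pairWeight J α (fun x y => x ∉ Λ ∧ y ∉ Λ ∧ P x y) := by
  rw [ofReal_pairSum_ind hd hJ hα]
  have hswap := pairWeight_swap (J := J) (α := α) fun x y => x ∈ Λ ∧ y ∉ Λ ∧ P x y
  have h2 : (2 : ENNReal) * 2⁻¹ = 1 := ENNReal.mul_inv_cancel (by norm_num) (by norm_num)
  calc _ ≤ pairWeight J α (fun x y => (((x ∈ Λ ∧ y ∈ Λ ∧ P x y) ∨ (x ∈ Λ ∧ y ∉ Λ ∧ P x y)) ∨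
        (y ∈ Λ ∧ x ∉ Λ ∧ P y x)) ∨ (x ∉ Λ ∧ y ∉ Λ ∧ P x y)) :=
        pairWeight_mono fun x y h => by have := hP x y h; tauto
    _ ≤ ((pairWeight J α (fun x y => x ∈ Λ ∧ y ∈ Λ ∧ P x y) +
          pairWeight J α (fun x y => x ∈ Λ ∧ y ∉ Λ ∧ P x y)) +
          pairWeight J α (fun x y => y ∈ Λ ∧ x ∉ Λ ∧ P y x)) +
          pairWeight J α (fun x y => x ∉ Λ ∧ y ∉ Λ ∧ P x y) :=
        (pairWeight_or_le _ _).trans (add_le_add_left ((pairWeight_or_le _ _).trans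
          (add_le_add_left (pairWeight_or_le _ _) _)) _)
    _ = _ := by
        rw [hswap, mul_add, ← mul_assoc, h2, one_mul]
        ring

end PairSum

section EnergyGap
variable {d q : ℕ} {M a : ℕ} {i₀ : Fin d} {σ : Zd d → ZMod q} {r : ZMod q}
  {E Γ : Finset (Finset (Zd d) × (Zd d → ZMod q))}

lemma sum_sub_eq_of_unique {x y : Zd d} {e : Finset (Zd d) × (Zd d → ZMod q)} (he : e ∈ Γ)
    (h : ∀ e' ∈ Γ, e' ≠ e → e'.2 x = e'.2 y) :
    ∑ e ∈ Γ, e.2 x - ∑ e ∈ Γ, e.2 y = e.2 x - e.2 y := by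
  rw [← Finset.sum_sub_distrib]
  exact Finset.sum_eq_single_of_mem e he fun e' he' hne => sub_eq_zero.2 (h e' he' hne)

/-- The pairwise gain from removing the potentials in `Γ`. -/
lemma Decomp.gain_le (h : Decomp i₀ M a σ r E) (hΓ : Γ ⊆ E) {φ : ZMod q → ℝ} {m₀ K : ℝ}
    (hm₀ : ∀ n, n ≠ 0 → m₀ ≤ φ 0 - φ n) (hK : ∀ n n', φ n - φ n' ≤ K) (x y : Zd d) :
    φ (σ x - σ y) + m₀ * (ind (Disc Γ x y)).toReal ≤
      φ ((σ x - ∑ e ∈ Γ, e.2 x) - (σ y - ∑ e ∈ Γ, e.2 y)) +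
        (m₀ + K) * (ind (Clash Γ E x y)).toReal := by
  by_cases hC : Clash Γ E x y
  · have hD : Disc Γ x y := by
      obtain ⟨e, he, -, -, -, hxy, -⟩ := hC
      exact ⟨e, he, hxy⟩
    rw [ind_of hC, ind_of hD, ENNReal.toReal_one]
    linarith [hK (σ x - σ y) ((σ x - ∑ e ∈ Γ, e.2 x) - (σ y - ∑ e ∈ Γ, e.2 y))]
  · rw [ind_of_not hC]
    by_cases hD : Disc Γ x y
    · obtain ⟨e, he, hxy⟩ := id hD
      have huniq : ∀ e' ∈ E, e' ≠ e → e'.2 x = e'.2 y := by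
        intro e' he' hne
        by_contra hc
        exact hC ⟨e, he, e', he', hne, hxy, hc⟩
      have h1 := sum_sub_eq_of_unique he fun e' he' => huniq e' (hΓ he')
      have h2 := sum_sub_eq_of_unique (hΓ he) huniq
      rw [h.sum, h.sum, sub_sub_sub_cancel_right] at h2
      have h3 : (σ x - ∑ e ∈ Γ, e.2 x) - (σ y - ∑ e ∈ Γ, e.2 y) = 0 := by
        rw [sub_sub_sub_comm, h1, h2, sub_self]
      have h4 : σ x - σ y ≠ 0 := by rw [h2]; exact sub_ne_zero.2 hxy
      rw [h3, ind_of hD, ENNReal.toReal_one, ENNReal.toReal_zero]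
      linarith [hm₀ _ h4]
    · have h1 : ∑ e ∈ Γ, e.2 x = ∑ e ∈ Γ, e.2 y := by
        refine Finset.sum_congr rfl fun e he => ?_
        by_contra hc
        exact hD ⟨e, he, hc⟩
      rw [h1, sub_sub_sub_cancel_right, ind_of_not hD]
      simp

/-- Removing the potentials in `Γ` lowers the energy proportionally to the size of `Γ`. -/
lemma Decomp.energy_gap [NeZero q] (h : Decomp i₀ M a σ r E) (hΓ : Γ ⊆ E) (hd : 0 < d) {J α : ℝ}
    (hJ : 0 ≤ J) (hα : (d : ℝ) < α) {φ : ZMod q → ℝ} {m₀ K κ : ℝ} (hm : 0 ≤ m₀)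
    (hm₀ : ∀ n, n ≠ 0 → m₀ ≤ φ 0 - φ n) (hK : ∀ n n', φ n - φ n' ≤ K) (hκ : 0 ≤ κ) (hκ1 : 2 * κ ≤ 1)
    (hκm : 8 * ((m₀ + K) * κ) ≤ m₀)
    (hclash : pairWeight J α (Clash Γ E) ≤ ENNReal.ofReal κ * pairWeight J α (Disc Γ))
    {Λ : Finset (Zd d)} (hr : ∀ x, x ∉ Λ → σ x = r) (hT : ∀ x, x ∉ Λ → ∑ e ∈ Γ, e.2 x = 0) :
    ham d q J α φ Λ r (fun x => σ x - ∑ e ∈ Γ, e.2 x) +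
      m₀ * J / 8 * (∑ e ∈ Γ, e.1.card : ℕ) ≤ ham d q J α φ Λ r σ := by
  obtain ⟨B, hB⟩ : ∃ B, ∀ n, |φ n| ≤ B := by
    refine ⟨∑ n, |φ n|, fun n => ?_⟩
    exact Finset.single_le_sum (f := fun n => |φ n|) (fun _ _ => abs_nonneg _) (Finset.mem_univ n)
  have hK0 : 0 ≤ K := by simpa using hK 0 0
  have hiD : ∀ x y, |(ind (Disc Γ x y)).toReal| ≤ 1 := fun x y => abs_toReal_ind_le _
  have hiC : ∀ x y, |(ind (Clash Γ E x y)).toReal| ≤ 1 := fun x y => abs_toReal_ind_le _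
  have hbound : ∀ (c c' : Zd d → Zd d → ℝ) (k : ℝ), (∀ x y, |c x y| ≤ B) →
      (∀ x y, |c' x y| ≤ 1) → ∀ x y, |c x y + k * c' x y| ≤ B + |k| := by
    intro c c' k hc hc' x y
    refine (abs_add_le _ _).trans (add_le_add (hc x y) ?_)
    rw [abs_mul]
    exact mul_le_of_le_one_right (abs_nonneg _) (hc' x y)
  set vF := pairSum J α Λ fun x y => (ind (Disc Γ x y)).toReal with hvF
  set vE := pairSum J α Λ fun x y => (ind (Clash Γ E x y)).toReal with hvE
  set ρ : Zd d → ZMod q := fun x => σ x - ∑ e ∈ Γ, e.2 x with hρ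
  have hmain : pairSum J α Λ (fun x y => φ (σ x - σ y)) + m₀ * vF ≤
      pairSum J α Λ (fun x y => φ (ρ x - ρ y)) + (m₀ + K) * vE := by
    rw [hvF, hvE, ← pairSum_add_mul hd hJ hα Λ (fun x y => hB (σ x - σ y)) hiD,
      ← pairSum_add_mul hd hJ hα Λ (fun x y => hB (ρ x - ρ y)) hiC]
    exact pairSum_mono hd hJ hα Λ (hbound _ _ _ (fun x y => hB _) hiD)
      (hbound _ _ _ (fun x y => hB _) hiC) (h.gain_le hΓ hm₀ hK)
  have hF := h.pairWeight_disc_ne_top hΓ hd hJ hα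
  set F := pairWeight J α (Disc Γ) with hFdef
  have hcc : pairWeight J α (fun x y => x ∉ Λ ∧ y ∉ Λ ∧ Disc Γ x y) ≤
      pairWeight J α (Clash Γ E) := by
    refine pairWeight_mono ?_
    rintro x y ⟨hx, hy, e, he, hxy⟩
    by_contra hC
    have h1 := sum_sub_eq_of_unique he fun e' he' hne => by
      by_contra hc
      exact hC ⟨e, he, e', hΓ he', hne, hxy, hc⟩
    rw [hT x hx, hT y hy, sub_self] at h1
    exact hxy (sub_eq_zero.1 h1.symm)
  have hvF0 : 0 ≤ vF := by
    have : pairSum J α Λ (fun _ _ => 0) = 0 := by simp [pairSum]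
    rw [← this]
    exact pairSum_mono hd hJ hα Λ (B := 0) (by simp) hiD fun x y => ENNReal.toReal_nonneg
  have hE1 : vE ≤ κ * F.toReal := by
    have h1 := (ofReal_pairSum_ind_le hd hJ hα Λ (Clash Γ E)).trans hclash
    rw [← ENNReal.ofReal_toReal hF, ← ENNReal.ofReal_mul hκ] at h1
    exact (ENNReal.ofReal_le_ofReal_iff (by positivity)).1 h1
  have hF1 : F.toReal ≤ 2 * vF + κ * F.toReal := by
    have h1 := (pairWeight_le_pairSum hd hJ hα Λ (P := Disc Γ) (fun x y ⟨e, he, hxy⟩ =>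
      ⟨e, he, hxy.symm⟩)).trans (add_le_add_right (hcc.trans hclash) _)
    rw [← hFdef, ← ENNReal.ofReal_toReal hF, ← ENNReal.ofReal_mul hκ, ← ENNReal.ofReal_ofNat,
      ← ENNReal.ofReal_mul (by norm_num), ← ENNReal.ofReal_add (by positivity) (by positivity)] at h1
    exact (ENNReal.ofReal_le_ofReal_iff (by positivity)).1 h1
  have hN : J * (∑ e ∈ Γ, e.1.card : ℕ) ≤ F.toReal := by
    have h1 := h.card_le_pairWeight hΓ J α
    rw [← hFdef, ← ENNReal.ofReal_natCast, ← ENNReal.ofReal_mul hJ,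
      ← ENNReal.ofReal_toReal hF] at h1
    exact (ENNReal.ofReal_le_ofReal_iff (by positivity)).1 h1
  have hρr : ∀ x, x ∉ Λ → ρ x = r := fun x hx => by simp only [hρ]; rw [hT x hx, hr x hx, sub_zero]
  rw [ham_eq_neg_pairSum hr, ham_eq_neg_pairSum hρr]
  have hFr : 0 ≤ F.toReal := ENNReal.toReal_nonneg
  have h4 : F.toReal ≤ 4 * vF := by nlinarith
  have h5 : (m₀ + K) * vE ≤ m₀ / 2 * vF := by
    calc (m₀ + K) * vE ≤ (m₀ + K) * (κ * (4 * vF)) :=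
          mul_le_mul_of_nonneg_left (hE1.trans (mul_le_mul_of_nonneg_left h4 hκ)) (by positivity)
      _ = (8 * ((m₀ + K) * κ)) * (vF / 2) := by ring
      _ ≤ m₀ * (vF / 2) := mul_le_mul_of_nonneg_right hκm (by positivity)
      _ = _ := by ring
  have h6 : m₀ * (J * (∑ e ∈ Γ, e.1.card : ℕ)) ≤ m₀ * (4 * vF) :=
    mul_le_mul_of_nonneg_left (hN.trans h4) hm
  push_cast at h6 ⊢
  linarith

end EnergyGap

lemma sum_filter_le_sum_sum_filter {Ω β : Type*} [Fintype Ω] (w : Ω → ENNReal) (s : Finset β)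
    {Q : Ω → Prop} [DecidablePred Q] {P : β → Ω → Prop} [∀ e, DecidablePred (P e)]
    (h : ∀ σ, Q σ → ∃ e ∈ s, P e σ) : ∑ σ with Q σ, w σ ≤ ∑ e ∈ s, ∑ σ with P e σ, w σ := by
  simp only [Finset.sum_filter]
  rw [Finset.sum_comm]
  refine Finset.sum_le_sum fun σ _ => ?_
  split_ifs with hσ
  · obtain ⟨e, he, hP⟩ := h σ hσ
    calc w σ = if P e σ then w σ else 0 := (if_pos hP).symm
      _ ≤ _ := Finset.single_le_sum (f := fun e => if P e σ then w σ else 0)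
        (fun _ _ => bot_le) he
  · exact bot_le

/-- If every family of contours either satisfies the exponential bound or must be extended by one
of few further contours, then the exponential bound holds for every family. -/
lemma sum_subset_le_of_extend {Ω β : Type*} [Fintype Ω] [DecidableEq β] (w : Ω → ENNReal)
    (𝓔 : Ω → Finset β) (N : β → ℕ) (z Z : ENNReal)
    (h : ∀ Γ : Finset β, (∑ σ with Γ ⊆ 𝓔 σ, w σ ≤ z ^ (∑ e ∈ Γ, N e) * Z) ∨
      ∃ s : Finset β, (∀ e ∈ s, e ∉ Γ) ∧ (∀ σ, Γ ⊆ 𝓔 σ → ∃ e ∈ s, e ∈ 𝓔 σ) ∧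
        ∑ e ∈ s, z ^ N e ≤ 1) (Γ : Finset β) :
    ∑ σ with Γ ⊆ 𝓔 σ, w σ ≤ z ^ (∑ e ∈ Γ, N e) * Z := by
  let U : Finset β := Finset.univ.biUnion 𝓔
  induction hk : (U \ Γ).card using Nat.strong_induction_on generalizing Γ with
  | _ k ih =>
    rcases h Γ with h1 | ⟨s, hs1, hs2, hs3⟩
    · exact h1
    have hins : ∀ e ∈ s, ∑ σ with insert e Γ ⊆ 𝓔 σ, w σ ≤ z ^ N e * (z ^ (∑ e ∈ Γ, N e) * Z) := by
      intro e he
      by_cases heU : e ∈ U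
      · have hlt : (U \ insert e Γ).card < k := by
          rw [← hk]
          refine Finset.card_lt_card ⟨Finset.sdiff_subset_sdiff le_rfl (Finset.subset_insert _ _),
            fun hc => ?_⟩
          have := hc (Finset.mem_sdiff.2 ⟨heU, hs1 e he⟩)
          simp at this
        have := ih _ hlt (insert e Γ) rfl
        rwa [Finset.sum_insert (hs1 e he), pow_add, mul_assoc] at this
      · rw [Finset.sum_eq_zero]
        · exact bot_le
        · intro σ hσ
          rw [Finset.mem_filter] at hσ
          exact absurd (Finset.mem_biUnion.2 ⟨σ, Finset.mem_univ _,
            hσ.2 (Finset.mem_insert_self _ _)⟩) heU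
    calc ∑ σ with Γ ⊆ 𝓔 σ, w σ ≤ ∑ e ∈ s, ∑ σ with insert e Γ ⊆ 𝓔 σ, w σ := by
          refine sum_filter_le_sum_sum_filter w s fun σ hσ => ?_
          obtain ⟨e, he, heσ⟩ := hs2 σ hσ
          exact ⟨e, he, Finset.insert_subset heσ hσ⟩
      _ ≤ ∑ e ∈ s, z ^ N e * (z ^ (∑ e ∈ Γ, N e) * Z) := Finset.sum_le_sum hins
      _ = (∑ e ∈ s, z ^ N e) * (z ^ (∑ e ∈ Γ, N e) * Z) := (Finset.sum_mul _ _ _).symm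
      _ ≤ _ := mul_le_of_le_one_left' hs3

section Peierls
variable {d q : ℕ} {M a : ℕ} {i₀ : Fin d}

/-- The Peierls bound: the probability that the origin has not the boundary colour is controlled
by the generating function of clusters. -/
lemma sum_ne_le [NeZero q] (hM : 1 ≤ M) {J α β c p : ℝ} (hp : 0 ≤ p) (hβ : 0 ≤ β) {φ : ZMod q → ℝ}
    {Λ : Finset (Zd d)} {r : ZMod q}
    {𝓔 : (Λ → ZMod q) → Finset (Finset (Zd d) × (Zd d → ZMod q))}
    (h𝓔 : ∀ σ, Decomp i₀ M a (extendCfg Λ (fun _ => r) σ) r (𝓔 σ))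
    (hgap : ∀ σ, ∀ Γ ⊆ 𝓔 σ, (∀ x, x ∉ Λ → ∑ e ∈ Γ, e.2 x = 0) →
      ham d q J α φ Λ r (fun x => extendCfg Λ (fun _ => r) σ x - ∑ e ∈ Γ, e.2 x) +
        c * (∑ e ∈ Γ, e.1.card : ℕ) ≤ ham d q J α φ Λ r (extendCfg Λ (fun _ => r) σ))
    {ζ z : ENNReal} (hz : z = ENNReal.ofReal (Real.exp (-(β * c))))
    (hζ : z * growthRate d q M a p * (1 - z * growthRate d q M a p)⁻¹ ≤ ζ) (hζ1 : ζ ≤ 1) (x₀ : Zd d) :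
    ∑ σ : Λ → ZMod q with extendCfg Λ (fun _ => r) σ x₀ ≠ r,
      ENNReal.ofReal (Real.exp (-(β * ham d q J α φ Λ r (extendCfg Λ (fun _ => r) σ)))) ≤
    ζ * ∑ σ : Λ → ZMod q,
      ENNReal.ofReal (Real.exp (-(β * ham d q J α φ Λ r (extendCfg Λ (fun _ => r) σ)))) := by
  classical
  set ext : (Λ → ZMod q) → Zd d → ZMod q := extendCfg Λ (fun _ => r) with hext
  have hout : ∀ σ x, x ∉ Λ → ext σ x = r := fun σ x hx => by simp [hext, extendCfg, hx]
  set w : (Λ → ZMod q) → ENNReal := fun σ =>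
    ENNReal.ofReal (Real.exp (-(β * ham d q J α φ Λ r (ext σ)))) with hw
  set Z : ENNReal := ∑ σ, w σ with hZ
  let U : Finset (Finset (Zd d) × (Zd d → ZMod q)) := Finset.univ.biUnion 𝓔
  have hU : ∀ e ∈ U, IsCluster M a e.1 ∧ IsPotential i₀ e.2 e.1 := by
    intro e he
    obtain ⟨σ, -, hσ⟩ := Finset.mem_biUnion.1 he
    exact ⟨(h𝓔 σ).cluster e hσ, (h𝓔 σ).pot e hσ⟩
  have hcount : ∀ (x : Zd d) (s : Finset (Finset (Zd d) × (Zd d → ZMod q))), s ⊆ U →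
      (∀ e ∈ s, e.2 x ≠ 0) → ∑ e ∈ s, z ^ e.1.card ≤ ζ := fun x s hs hx =>
    (sum_pow_card_le hM hp (fun e he => (hU e (hs he)).1) (fun e he => (hU e (hs he)).2) hx z).trans
      hζ
  have hbound := sum_subset_le_of_extend w 𝓔 (fun e => e.1.card) z Z fun Γ => by
    by_cases hT : ∀ x, x ∉ Λ → ∑ e ∈ Γ, e.2 x = 0
    · left
      let sub : (Λ → ZMod q) → Λ → ZMod q := fun σ x => σ x - ∑ e ∈ Γ, e.2 x
      have hsub : Function.Injective sub := by
        intro σ σ' h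
        funext x
        exact sub_left_injective (congrFun h x)
      have hextsub : ∀ σ, ext (sub σ) = fun x => ext σ x - ∑ e ∈ Γ, e.2 x := by
        intro σ
        funext x
        by_cases hx : x ∈ Λ
        · simp [hext, extendCfg, hx, sub]
        · rw [hout _ _ hx, hout _ _ hx, hT x hx, sub_zero]
      have hle : ∀ σ, Γ ⊆ 𝓔 σ → w σ ≤ z ^ (∑ e ∈ Γ, e.1.card) * w (sub σ) := by
        intro σ hσ
        have := hgap σ Γ hσ hT
        rw [hz, ← ENNReal.ofReal_pow (Real.exp_nonneg _), ← Real.exp_nat_mul]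
        simp only [hw]
        rw [← ENNReal.ofReal_mul (Real.exp_nonneg _), ← Real.exp_add, hextsub]
        refine ENNReal.ofReal_le_ofReal (Real.exp_le_exp.2 ?_)
        have h2 := mul_le_mul_of_nonneg_left this hβ
        linarith
      calc ∑ σ with Γ ⊆ 𝓔 σ, w σ
          ≤ ∑ σ with Γ ⊆ 𝓔 σ, z ^ (∑ e ∈ Γ, e.1.card) * w (sub σ) :=
            Finset.sum_le_sum fun σ hσ => hle σ (Finset.mem_filter.1 hσ).2
        _ = z ^ (∑ e ∈ Γ, e.1.card) * ∑ σ with Γ ⊆ 𝓔 σ, w (sub σ) := (Finset.mul_sum _ _ _).symm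
        _ ≤ _ := by
            refine mul_le_mul_right ?_ _
            rw [← Finset.sum_image (g := sub) (f := w) hsub.injOn]
            exact Finset.sum_le_sum_of_subset (Finset.subset_univ _)
    · right
      push Not at hT
      obtain ⟨x, hx, hTx⟩ := hT
      refine ⟨(U.filter fun e => e.2 x ≠ 0) \ Γ, fun e he => (Finset.mem_sdiff.1 he).2, ?_, ?_⟩
      · intro σ hσ
        by_contra hcon
        push Not at hcon
        have h0 := (h𝓔 σ).sum x
        rw [hout σ x hx, sub_self] at h0
        refine hTx ((Finset.sum_subset hσ fun e he heΓ => ?_).trans h0)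
        by_contra hne
        refine hcon e (Finset.mem_sdiff.2 ⟨Finset.mem_filter.2 ⟨?_, hne⟩, heΓ⟩) he
        exact Finset.mem_biUnion.2 ⟨σ, Finset.mem_univ _, he⟩
      · refine (hcount x _ (Finset.sdiff_subset.trans (Finset.filter_subset _ _)) ?_).trans hζ1
        intro e he
        exact (Finset.mem_filter.1 (Finset.mem_sdiff.1 he).1).2
  calc ∑ σ with ext σ x₀ ≠ r, w σ
      ≤ ∑ e ∈ U.filter (fun e => e.2 x₀ ≠ 0), ∑ σ with {e} ⊆ 𝓔 σ, w σ := by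
        refine sum_filter_le_sum_sum_filter w _ fun σ hσ => ?_
        have h0 : ∑ e ∈ 𝓔 σ, e.2 x₀ ≠ 0 := by
          rw [(h𝓔 σ).sum]; exact sub_ne_zero.2 hσ
        obtain ⟨e, he, hne⟩ := Finset.exists_ne_zero_of_sum_ne_zero h0
        exact ⟨e, Finset.mem_filter.2 ⟨Finset.mem_biUnion.2 ⟨σ, Finset.mem_univ _, he⟩, hne⟩,
          Finset.singleton_subset_iff.2 he⟩
    _ ≤ ∑ e ∈ U.filter (fun e => e.2 x₀ ≠ 0), z ^ e.1.card * Z := by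
        refine Finset.sum_le_sum fun e _ => ?_
        simpa using hbound {e}
    _ = (∑ e ∈ U.filter (fun e => e.2 x₀ ≠ 0), z ^ e.1.card) * Z := (Finset.sum_mul _ _ _).symm
    _ ≤ ζ * Z := mul_le_mul_left (hcount x₀ _ (Finset.filter_subset _ _) fun e he =>
        (Finset.mem_filter.1 he).2) _

end Peierls

section Constants
variable {d q : ℕ}

lemma basel_ne_top : basel ≠ ⊤ := by
  have h : Summable fun n : ℕ => (((n + 1 : ℕ) : ℝ) ^ 2)⁻¹ :=
    (summable_nat_add_iff 1).2 (Real.summable_nat_pow_inv.2 one_lt_two)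
  refine ne_of_eq_of_ne (tsum_congr fun n => ?_) h.tsum_ofReal_ne_top
  rw [ENNReal.ofReal_inv_of_pos (by positivity), ENNReal.ofReal_pow (by positivity),
    ENNReal.ofReal_natCast]

lemma sq_mul_couplingTail_le {J α δ : ℝ} (hJ : 0 ≤ J) (hα : 0 ≤ α) (hδ : 0 ≤ δ) {a m n : ℕ}
    (ha : 2 ≤ a * δ) (hm : 1 ≤ m) (hn : 1 ≤ n) :
    (n : ENNReal) ^ 2 * couplingTail d J α (4 * (m * n ^ a)) ≤
      ENNReal.ofReal (J * 2 ^ α * (m : ℝ) ^ (-δ)) * ∑' z : Zd d, polyWeight (α - δ) z := by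
  have hR : 1 ≤ 4 * (m * n ^ a) := Nat.mul_pos (by norm_num) (Nat.mul_pos hm (Nat.pow_pos hn))
  refine (mul_le_mul_right (couplingTail_le hJ hα hδ hR) _).trans ?_
  rw [← mul_assoc]
  refine mul_le_mul_left ?_ _
  rw [← ENNReal.ofReal_natCast, ← ENNReal.ofReal_pow (by positivity),
    ← ENNReal.ofReal_mul (by positivity)]
  apply ENNReal.ofReal_le_ofReal
  have hm' : (0 : ℝ) < m := by exact_mod_cast hm
  have hn' : (1 : ℝ) ≤ n := by exact_mod_cast hn
  have hn0 : (0 : ℝ) < n := by linarith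
  have h1 : ((4 * (m * n ^ a) : ℕ) : ℝ) ^ (-δ) ≤ (m : ℝ) ^ (-δ) * ((n : ℝ) ^ 2)⁻¹ := by
    calc ((4 * (m * n ^ a) : ℕ) : ℝ) ^ (-δ) ≤ ((m : ℝ) * (n : ℝ) ^ a) ^ (-δ) := by
          refine Real.rpow_le_rpow_of_nonpos (by positivity) ?_ (by linarith)
          push_cast
          have : 0 < (m : ℝ) * (n : ℝ) ^ a := by positivity
          linarith
      _ = (m : ℝ) ^ (-δ) * (n : ℝ) ^ (a * -δ) := by
          rw [Real.mul_rpow hm'.le (by positivity), ← Real.rpow_natCast, ← Real.rpow_mul hn0.le]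
      _ ≤ (m : ℝ) ^ (-δ) * (n : ℝ) ^ (-2 : ℝ) := by
          refine mul_le_mul_of_nonneg_left (Real.rpow_le_rpow_of_exponent_le hn' ?_)
            (by positivity)
          linarith
      _ = _ := by rw [Real.rpow_neg hn0.le]; norm_cast
  calc (n : ℝ) ^ 2 * (J * 2 ^ α * ((4 * (m * n ^ a) : ℕ) : ℝ) ^ (-δ))
      ≤ (n : ℝ) ^ 2 * (J * 2 ^ α * ((m : ℝ) ^ (-δ) * ((n : ℝ) ^ 2)⁻¹)) := by gcongr
    _ = _ := by field_simp

/-- For a large separation constant the clash weight is a small multiple of the energy. -/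
lemma exists_separation {J α : ℝ} (hd : 0 < d) (hJ : 0 < J) (hα : (d : ℝ) < α) {κ : ℝ}
    (hκ : 0 < κ) : ∃ m a : ℕ, 1 ≤ m ∧ ∀ (i₀ : Fin d) (σ : Zd d → ZMod q) (r : ZMod q)
      (E Γ : Finset (Finset (Zd d) × (Zd d → ZMod q))), Decomp i₀ (8 * m) a σ r E → Γ ⊆ E →
      pairWeight J α (Clash Γ E) ≤ ENNReal.ofReal κ * pairWeight J α (Disc Γ) := by
  have hd' : (0 : ℝ) < d := by exact_mod_cast hd
  have hα0 : 0 ≤ α := by linarith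
  set δ : ℝ := (α - d) / 2 with hδ
  have hδ0 : 0 < δ := by linarith
  obtain ⟨a, ha⟩ := exists_nat_ge (2 / δ)
  have ha2 : 2 ≤ ((max a 4 : ℕ) : ℝ) * δ := by
    rw [div_le_iff₀ hδ0] at ha
    refine ha.trans (mul_le_mul_of_nonneg_right ?_ hδ0.le)
    exact_mod_cast le_max_left a 4
  set S : ENNReal := ∑' z : Zd d, polyWeight (α - δ) z with hS
  have hS' : S ≠ ⊤ := tsum_polyWeight_ne_top hd (by linarith)
  have hJ0 : ENNReal.ofReal J ≠ 0 := by simpa using hJ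
  have h1 : Tendsto (fun m : ℕ => 2 * (ENNReal.ofReal (J * 2 ^ α * (m : ℝ) ^ (-δ)) * S) /
      ENNReal.ofReal J) atTop (nhds 0) := by
    have t1 : Tendsto (fun m : ℕ => J * 2 ^ α * (m : ℝ) ^ (-δ)) atTop (nhds 0) := by
      simpa using ((tendsto_rpow_neg_atTop hδ0).comp tendsto_natCast_atTop_atTop).const_mul
        (J * 2 ^ α)
    have t2 := ENNReal.tendsto_ofReal t1
    have t3 := ENNReal.Tendsto.mul_const t2 (Or.inr hS')
    have t4 := ENNReal.Tendsto.const_mul (a := 2) t3 (Or.inr (by norm_num))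
    have t5 := ENNReal.Tendsto.div_const t4 (Or.inr hJ0)
    simpa using t5
  have h2 : Tendsto (fun m : ℕ => 2 * (ENNReal.ofReal (2 ^ α) / m * basel)) atTop (nhds 0) := by
    have t1 := ENNReal.Tendsto.const_mul (a := ENNReal.ofReal (2 ^ α))
      ENNReal.tendsto_inv_nat_nhds_zero (Or.inr (by simp))
    have t2 := ENNReal.Tendsto.mul_const t1 (Or.inr basel_ne_top)
    have t3 := ENNReal.Tendsto.const_mul (a := 2) t2 (Or.inr (by norm_num))
    simpa [div_eq_mul_inv] using t3
  have h3 := h1.add h2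
  rw [add_zero] at h3
  have hκ' : (0 : ENNReal) < ENNReal.ofReal κ := by simpa using hκ
  obtain ⟨m, hm, hm1⟩ := ((h3.eventually_lt_const hκ').and (eventually_ge_atTop 1)).exists
  refine ⟨m, max a 4, hm1, fun i₀ σ r E Γ h hΓ => ?_⟩
  exact (h.clash_le hm1 (le_max_right _ _) hJ hα0 hΓ
    fun n hn => sq_mul_couplingTail_le hJ.le hα0 hδ0.le ha2 hm1 hn).trans
    (mul_le_mul_left hm.le _)

lemma exists_gap [NeZero q] {φ : ZMod q → ℝ} (hφ : ∀ n : ZMod q, n ≠ 0 → φ n < φ 0) :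
    ∃ m₀ K : ℝ, 0 < m₀ ∧ 0 ≤ K ∧ (∀ n, n ≠ 0 → m₀ ≤ φ 0 - φ n) ∧ ∀ n n', φ n - φ n' ≤ K := by
  obtain ⟨n₁, h₁⟩ := Finite.exists_min fun n : ZMod q => if n = 0 then 1 else φ 0 - φ n
  obtain ⟨p, hp⟩ := Finite.exists_max fun p : ZMod q × ZMod q => φ p.1 - φ p.2
  refine ⟨if n₁ = 0 then 1 else φ 0 - φ n₁, φ p.1 - φ p.2, ?_, ?_, fun n hn => ?_, fun n n' =>
    hp (n, n')⟩
  · split_ifs with h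
    · exact one_pos
    · exact sub_pos.2 (hφ _ h)
  · simpa using hp (0, 0)
  · simpa [hn] using h₁ n

lemma growthRate_ne_top (hd : 0 < d) {M a : ℕ} {p : ℝ} (hp : (d : ℝ) < p) :
    growthRate d q M a p ≠ ⊤ := by
  have := tsum_polyWeight_ne_top hd hp
  exact ENNReal.mul_ne_top ENNReal.ofReal_ne_top
    (ENNReal.pow_ne_top (ENNReal.add_ne_top.2 ⟨by simp, ENNReal.mul_ne_top (by simp) this⟩))

lemma exists_beta {B : ENNReal} (hB : B ≠ ⊤) {c η : ℝ} (hc : 0 < c) (hη : 0 < η) (hη1 : η ≤ 1) :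
    ∃ β₀ : ℝ, 0 < β₀ ∧ ∀ β, β₀ < β →
      ENNReal.ofReal (Real.exp (-(β * c))) * B *
        (1 - ENNReal.ofReal (Real.exp (-(β * c))) * B)⁻¹ ≤ ENNReal.ofReal η := by
  have hb : 0 ≤ B.toReal := ENNReal.toReal_nonneg
  refine ⟨2 * B.toReal / (η * c) + 1, by positivity, fun β hβ => ?_⟩
  have hβ0 : 0 < β := lt_trans (by positivity) hβ
  have hx : Real.exp (-(β * c)) * B.toReal ≤ η / 2 := by
    have h1 : β * c ≤ Real.exp (β * c) := by linarith [Real.add_one_le_exp (β * c)]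
    have h2 : 2 * B.toReal ≤ β * (η * c) := by
      rw [← div_le_iff₀ (by positivity)]; linarith
    rw [Real.exp_neg, inv_mul_le_iff₀ (Real.exp_pos _)]
    nlinarith
  set u : ENNReal := ENNReal.ofReal (Real.exp (-(β * c))) * B with hu
  have hu' : u ≤ ENNReal.ofReal (η / 2) := by
    rw [hu, ← ENNReal.ofReal_toReal hB, ← ENNReal.ofReal_mul (Real.exp_nonneg _)]
    exact ENNReal.ofReal_le_ofReal hx
  have h1 : (2 : ENNReal)⁻¹ ≤ 1 - u := by
    have h2 : u ≤ 2⁻¹ := by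
      refine hu'.trans ?_
      rw [← ENNReal.ofReal_ofNat, ← ENNReal.ofReal_inv_of_pos (by norm_num)]
      exact ENNReal.ofReal_le_ofReal (by linarith)
    calc (2 : ENNReal)⁻¹ = 1 - 2⁻¹ := ENNReal.one_sub_inv_two.symm
      _ ≤ 1 - u := tsub_le_tsub_left h2 _
  calc u * (1 - u)⁻¹ ≤ ENNReal.ofReal (η / 2) * 2 := by
        refine mul_le_mul' hu' ?_
        rw [← inv_inv (2 : ENNReal)]
        exact ENNReal.inv_le_inv.2 h1
    _ = ENNReal.ofReal η := by
        rw [← ENNReal.ofReal_ofNat 2, ← ENNReal.ofReal_mul (by positivity)]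
        congr 1
        ring

end Constants

/-- **Phase transition for long-range `q`-state ferromagnetic models** (Theorem 1.1):
for every `C ∈ [0,1)` there is `β₀ > 0` such that for all `β > β₀`, all finite
`Λ ∋ 0` and all colours `r`, the finite-volume Gibbs measure with monochromatic
boundary condition `r` gives the event `σ_0 = r` probability greater than `C`. -/
theorem phase_transition_qstate_long_range
    (d q : ℕ) (hd : 2 ≤ d) [NeZero q] (hq : 2 ≤ q)
    (α J : ℝ) (hα : (d : ℝ) < α) (hJ : 0 < J)
    (φ : ZMod q → ℝ) (hφ : ∀ n : ZMod q, n ≠ 0 → φ n < φ 0)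
    (C : ℝ) (hC0 : 0 ≤ C) (hC1 : C < 1) :
    ∃ β₀ : ℝ, 0 < β₀ ∧ ∀ β : ℝ, β₀ < β →
      ∀ Λ : Finset (Zd d), (0 : Zd d) ∈ Λ → ∀ r : ZMod q,
        C < (∑ σ : Λ → ZMod q,
                if extendCfg Λ (fun _ => r) σ 0 = r then
                  Real.exp (-(β * ham d q J α φ Λ r (extendCfg Λ (fun _ => r) σ)))
                else 0)
            / (∑ σ : Λ → ZMod q,
                Real.exp (-(β * ham d q J α φ Λ r (extendCfg Λ (fun _ => r) σ)))) := by
  have hd0 : 0 < d := by omega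
  have hα0 : 0 ≤ α := le_trans (by positivity) hα.le
  obtain ⟨m₀, K, hm₀, hK0, hm, hK⟩ := exists_gap hφ
  obtain ⟨κ, hκ, hκ1, hκm⟩ : ∃ κ : ℝ, 0 < κ ∧ 2 * κ ≤ 1 ∧ 8 * ((m₀ + K) * κ) ≤ m₀ := by
    refine ⟨m₀ / (8 * (m₀ + K)), by positivity, ?_, le_of_eq (by field_simp)⟩
    rw [← mul_div_assoc, div_le_one (by positivity)]
    linarith
  obtain ⟨m, a, hm1, hclash⟩ := exists_separation (q := q) hd0 hJ hα hκ
  have hc : 0 < m₀ * J / 8 := by positivity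
  obtain ⟨β₀, hβ₀, hβ⟩ := exists_beta (growthRate_ne_top (q := q) (M := 8 * m) (a := a) hd0 hα) hc
    (η := (1 - C) / 2) (by linarith) (by linarith)
  refine ⟨β₀, hβ₀, fun β hββ Λ _ r => ?_⟩
  let i₀ : Fin d := ⟨0, by omega⟩
  let i₁ : Fin d := ⟨1, by omega⟩
  have hi : i₁ ≠ i₀ := by simp [i₀, i₁]
  have hout : ∀ (σ : Λ → ZMod q) x, x ∉ Λ → extendCfg Λ (fun _ => r) σ x = r :=
    fun σ x hx => by simp [extendCfg, hx]
  choose 𝓔 h𝓔 using fun σ : Λ → ZMod q => exists_decomp (M := 8 * m) (a := a) hi (by omega) (hout σ)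
  have hbad := sum_ne_le (by omega) hα0 (hβ₀.trans hββ).le h𝓔
    (fun σ Γ hΓ hT => (h𝓔 σ).energy_gap hΓ hd0 hJ.le hα hm₀.le hm hK hκ.le hκ1 hκm
      (hclash _ _ _ _ _ (h𝓔 σ) hΓ) (hout σ) hT) rfl (hβ β hββ)
    (ENNReal.ofReal_le_one.2 (by linarith)) 0
  set w : (Λ → ZMod q) → ℝ := fun σ =>
    Real.exp (-(β * ham d q J α φ Λ r (extendCfg Λ (fun _ => r) σ))) with hw
  have hwpos : ∀ σ, 0 < w σ := fun σ => Real.exp_pos _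
  have hZ : 0 < ∑ σ, w σ := Finset.sum_pos (fun σ _ => hwpos σ) Finset.univ_nonempty
  rw [← ENNReal.ofReal_sum_of_nonneg fun σ _ => (hwpos σ).le,
    ← ENNReal.ofReal_sum_of_nonneg fun σ _ => (hwpos σ).le,
    ← ENNReal.ofReal_mul (by linarith),
    ENNReal.ofReal_le_ofReal_iff (mul_nonneg (by linarith) hZ.le)] at hbad
  have hsplit := Finset.sum_filter_add_sum_filter_not Finset.univ
    (fun σ : Λ → ZMod q => extendCfg Λ (fun _ => r) σ 0 = r) w
  rw [lt_div_iff₀ hZ, ← Finset.sum_filter]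
  nlinarith
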